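/- arXiv:0911.4279 — 2 statements merged into one kernel-verified Lean document; each statement's English description precedes it below -/
import Mathlib

section
/- Let 0 < s < 1/2 and let β be the Kac cross-section. Let f₀ ∈ L¹_{2+2s}(ℝ) ∩ L log L(ℝ) with f₀ ≥ 0 and f₀ not identically zero, and let f ∈ L∞((0,∞); L¹_{2+2s}(ℝ) ∩ L log L(ℝ)) be a nonnegative weak solution of the Cauchy problem ∂_t f = K(f,f), f|_{t=0} = f₀. Then for every t > 0 and every k ∈ ℕ the function ⟨v⟩² f(t,·) belongs to H^k(ℝ); that is, f(t,·) ∈ H^{+∞}₂(ℝ) for all t > 0. -/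
open MeasureTheory Real intervalIntegral

noncomputable section

/-- Japanese bracket `⟨v⟩ = (1+v²)^{1/2}`. -/
def jap (v : ℝ) : ℝ := Real.sqrt (1 + v ^ 2)

/-- Fourier transform on `ℝ`: `𝓕u(ξ) = ∫ e^{-2πivξ} u(v) dv`. -/
def FT (u : ℝ → ℂ) (ξ : ℝ) : ℂ :=
  ∫ v : ℝ, Complex.exp (-(2 * Real.pi * v * ξ) * Complex.I) * u v

/-- Kac non-cutoff cross-section `β(θ) = C₀ |cos θ| / |sin θ|^{1+2s}`. -/
def kacBeta (C₀ s θ : ℝ) : ℝ := C₀ * |Real.cos θ| / |Real.sin θ| ^ (1 + 2 * s)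

/-- `f` is a nonnegative weak solution on `[0,T]` of the Cauchy problem for the
spatially homogeneous non-cutoff Kac equation `∂ₜf = K(f,f)`, `f|_{t=0} = f₀`:
the weak formulation holds against all test functions `φ` that are `C¹` in `t`
and `C²` in `v` and bounded together with these derivatives; moreover `f`
conserves mass and energy and satisfies the entropy inequality. -/
structure IsWeakKacSolution (C₀ s T : ℝ) (f₀ : ℝ → ℝ) (f : ℝ → ℝ → ℝ) : Prop where
  nonneg : ∀ t ∈ Set.Icc (0 : ℝ) T, ∀ v : ℝ, 0 ≤ f t v
  weak_eq : ∀ φ φt : ℝ → ℝ → ℝ,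
    (∀ v t : ℝ, HasDerivAt (fun τ => φ τ v) (φt t v) t) →
    (∀ t : ℝ, ContDiff ℝ 2 (fun v => φ t v)) →
    (∃ M : ℝ, ∀ t v : ℝ, |φ t v| ≤ M ∧ |φt t v| ≤ M ∧
        |deriv (fun w => φ t w) v| ≤ M ∧ |deriv (deriv (fun w => φ t w)) v| ≤ M) →
    ∀ t ∈ Set.Icc (0 : ℝ) T,
      (∫ v : ℝ, f t v * φ t v) - ∫ v : ℝ, f₀ v * φ 0 v
        = (∫ τ in (0 : ℝ)..t, ∫ v : ℝ, f τ v * φt τ v)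
          + ∫ τ in (0 : ℝ)..t, ∫ v : ℝ, ∫ vs : ℝ,
              ∫ θ in (-(Real.pi / 2))..(Real.pi / 2),
                kacBeta C₀ s θ * f τ vs * f τ v *
                  (φ τ (v * Real.cos θ - vs * Real.sin θ) - φ τ v)
  mass : ∀ t ∈ Set.Icc (0 : ℝ) T, (∫ v : ℝ, f t v) = ∫ v : ℝ, f₀ v
  energy : ∀ t ∈ Set.Icc (0 : ℝ) T, (∫ v : ℝ, f t v * v ^ 2) = ∫ v : ℝ, f₀ v * v ^ 2
  entropy : ∀ t ∈ Set.Icc (0 : ℝ) T,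
    (∫ v : ℝ, f t v * Real.log (f t v)) ≤ ∫ v : ℝ, f₀ v * Real.log (f₀ v)

lemma kacBeta_nonneg {C₀ : ℝ} (hC₀ : 0 ≤ C₀) (s θ : ℝ) : 0 ≤ kacBeta C₀ s θ := by
  unfold kacBeta; positivity

lemma measurable_kacBeta (C₀ s : ℝ) : Measurable (kacBeta C₀ s) := by
  unfold kacBeta; fun_prop

/-- Lebesgue measure on the range of collision angles. -/
def angleMeasure : Measure ℝ := volume.restrict (Set.Ioc (-(π / 2)) (π / 2))

instance : SFinite angleMeasure := by unfold angleMeasure; infer_instance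

lemma ae_angle_mem : ∀ᵐ θ ∂angleMeasure, θ ∈ Set.Icc (-(π / 2)) (π / 2) := by
  unfold angleMeasure
  filter_upwards [ae_restrict_mem measurableSet_Ioc] with θ hθ using ⟨hθ.1.le, hθ.2⟩

lemma two_div_pi_mul_abs_le_abs_sin {θ : ℝ} (hθ : θ ∈ Set.Icc (-(π / 2)) (π / 2)) :
    2 / π * |θ| ≤ |sin θ| :=
  mul_abs_le_abs_sin (abs_le.2 hθ)

lemma integrable_kacBeta_mul_abs_sin {C₀ s : ℝ} (hC₀ : 0 ≤ C₀) (hs0 : 0 < s) (hs : s < 1 / 2) :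
    Integrable (fun θ => kacBeta C₀ s θ * |sin θ|) angleMeasure := by
  have hint : Integrable (fun θ : ℝ => C₀ * ((2 / π) ^ (-(2 * s)) * |θ| ^ (-(2 * s))))
      angleMeasure := by
    refine Integrable.const_mul (Integrable.const_mul ?_ _) _
    have h1 : ∀ a : ℝ, 0 ≤ a → IntervalIntegrable (fun θ : ℝ => |θ| ^ (-(2 * s))) volume 0 a := by
      intro a ha
      refine (intervalIntegrable_rpow' (a := 0) (b := a) (r := -(2 * s)) (by linarith)).congr ?_
      intro θ hθ
      rw [Set.uIoc_of_le ha] at hθ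
      simp [abs_of_pos hθ.1]
    have hp : 0 ≤ π / 2 := by positivity
    have h2 := h1 _ hp
    have h3 : IntervalIntegrable (fun θ : ℝ => |θ| ^ (-(2 * s))) volume (-(π / 2)) 0 := by
      have := (IntervalIntegrable.iff_comp_neg (f := fun θ : ℝ => |θ| ^ (-(2 * s)))).1 h2
      simpa using this.symm
    have h4 := h3.trans h2
    rwa [intervalIntegrable_iff_integrableOn_Ioc_of_le (by linarith)] at h4
  refine hint.mono' ((measurable_kacBeta C₀ s).mul (by fun_prop)).aestronglyMeasurable ?_
  filter_upwards [ae_angle_mem] with θ hθ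
  rw [Real.norm_of_nonneg (mul_nonneg (kacBeta_nonneg hC₀ s θ) (abs_nonneg _))]
  have hl := two_div_pi_mul_abs_le_abs_sin hθ
  rcases eq_or_ne θ 0 with rfl | h0
  · simp only [sin_zero, abs_zero, mul_zero]
    positivity
  have hpos : 0 < |θ| := abs_pos.2 h0
  have hsin : 0 < |sin θ| := lt_of_lt_of_le (by positivity) hl
  have e : kacBeta C₀ s θ * |sin θ| = C₀ * (|cos θ| * |sin θ| ^ (-(2 * s))) := by
    unfold kacBeta
    rw [rpow_add hsin, rpow_one, rpow_neg hsin.le]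
    field_simp
  rw [e]
  refine mul_le_mul_of_nonneg_left ?_ hC₀
  calc |cos θ| * |sin θ| ^ (-(2 * s)) ≤ 1 * |sin θ| ^ (-(2 * s)) := by
        gcongr; exact abs_cos_le_one θ
    _ ≤ (2 / π * |θ|) ^ (-(2 * s)) := by
        rw [one_mul]
        exact rpow_le_rpow_of_nonpos (by positivity) hl (by linarith)
    _ = _ := by rw [mul_rpow (by positivity) hpos.le]

lemma sin_sq_le_abs_sin (θ : ℝ) : sin θ ^ 2 ≤ |sin θ| := by
  rw [← sq_abs]
  nlinarith [abs_nonneg (sin θ), abs_sin_le_one θ]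

lemma one_sub_cos_le_abs_sin {θ : ℝ} (hθ : θ ∈ Set.Icc (-(π / 2)) (π / 2)) :
    |cos θ - 1| ≤ |sin θ| := by
  have h0 := cos_nonneg_of_mem_Icc hθ
  have h1 := cos_le_one θ
  rw [abs_sub_comm, abs_of_nonneg (by linarith)]
  refine le_trans ?_ (sin_sq_le_abs_sin θ)
  nlinarith [sin_sq_add_cos_sq θ]

section FourierTransform

lemma integral_re_eq {α : Type*} [MeasurableSpace α] {μ : Measure α} {u : α → ℂ}
    (hu : Integrable u μ) : ∫ x, (u x).re ∂μ = (∫ x, u x ∂μ).re :=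
  Complex.reCLM.integral_comp_comm hu

lemma integral_im_eq {α : Type*} [MeasurableSpace α] {μ : Measure α} {u : α → ℂ}
    (hu : Integrable u μ) : ∫ x, (u x).im ∂μ = (∫ x, u x ∂μ).im :=
  Complex.imCLM.integral_comp_comm hu

/-- The Fourier character `v ↦ e^{-2πivξ}`. -/
def fourierExp (ξ v : ℝ) : ℂ := Complex.exp (-(2 * Real.pi * v * ξ) * Complex.I)

lemma fourierExp_eq (ξ v : ℝ) :
    fourierExp ξ v = Complex.exp (((-(2 * π * v * ξ) : ℝ) : ℂ) * Complex.I) := by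
  unfold fourierExp; push_cast; rfl

lemma norm_fourierExp (ξ v : ℝ) : ‖fourierExp ξ v‖ = 1 := by
  rw [fourierExp_eq, Complex.norm_exp_ofReal_mul_I]

lemma fourierExp_re (ξ v : ℝ) : (fourierExp ξ v).re = cos (2 * π * ξ * v) := by
  rw [fourierExp_eq, Complex.exp_ofReal_mul_I_re, cos_neg]; ring_nf

lemma fourierExp_im (ξ v : ℝ) : (fourierExp ξ v).im = -sin (2 * π * ξ * v) := by
  rw [fourierExp_eq, Complex.exp_ofReal_mul_I_im, sin_neg]; ring_nf

lemma continuous_fourierExp : Continuous (fun p : ℝ × ℝ => fourierExp p.1 p.2) := by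
  unfold fourierExp; fun_prop

lemma continuous_fourierExp_right (ξ : ℝ) : Continuous (fourierExp ξ) :=
  continuous_fourierExp.comp (by fun_prop : Continuous fun v : ℝ => (ξ, v))

lemma norm_fourierExp_sub_le (ξ η v : ℝ) :
    ‖fourierExp ξ v - fourierExp η v‖ ≤ 2 * π * |ξ - η| * |v| := by
  have e : fourierExp ξ v - fourierExp η v
      = fourierExp η v * (Complex.exp (Complex.I * ((-(2 * π * v * (ξ - η)) : ℝ) : ℂ)) - 1) := by
    rw [mul_sub, mul_one]; unfold fourierExp
    rw [← Complex.exp_add]; congr 2; push_cast; ring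
  rw [e, norm_mul, norm_fourierExp, one_mul]
  refine (norm_exp_I_mul_ofReal_sub_one_le).trans_eq ?_
  rw [Real.norm_eq_abs, abs_neg, abs_mul, abs_mul, abs_mul, abs_of_pos pi_pos]
  simp; ring

lemma FT_eq (u : ℝ → ℂ) (ξ : ℝ) : FT u ξ = ∫ v, fourierExp ξ v * u v := rfl

variable {g : ℝ → ℝ}

lemma integrable_fourierExp_mul (hg : Integrable g) (ξ : ℝ) :
    Integrable (fun v => fourierExp ξ v * (g v : ℂ)) :=
  hg.ofReal.bdd_mul (continuous_fourierExp_right ξ).aestronglyMeasurable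
    (ae_of_all _ fun v => (norm_fourierExp ξ v).le)

lemma FT_re (hg : Integrable g) (ξ : ℝ) :
    (FT (fun v => (g v : ℂ)) ξ).re = ∫ v, g v * cos (2 * π * ξ * v) := by
  rw [FT_eq, ← integral_re_eq (integrable_fourierExp_mul hg ξ)]
  refine integral_congr_ae (ae_of_all _ fun v => ?_)
  simp [fourierExp_re, mul_comm]

lemma FT_im (hg : Integrable g) (ξ : ℝ) :
    (FT (fun v => (g v : ℂ)) ξ).im = -∫ v, g v * sin (2 * π * ξ * v) := by
  rw [FT_eq, ← integral_im_eq (integrable_fourierExp_mul hg ξ), ← MeasureTheory.integral_neg]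
  refine integral_congr_ae (ae_of_all _ fun v => ?_)
  simp [fourierExp_im, mul_comm]

lemma FT_zero : FT (fun v => (g v : ℂ)) 0 = ((∫ v, g v : ℝ) : ℂ) := by
  simp only [FT_eq, ← integral_complex_ofReal]
  simp [fourierExp]

lemma norm_FT_le (hnn : ∀ v, 0 ≤ g v) (ξ : ℝ) : ‖FT (fun v => (g v : ℂ)) ξ‖ ≤ ∫ v, g v := by
  rw [FT_eq]
  refine (MeasureTheory.norm_integral_le_integral_norm _).trans_eq ?_
  refine integral_congr_ae (ae_of_all _ fun v => ?_)
  simp [norm_fourierExp, abs_of_nonneg (hnn v)]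

lemma norm_FT_sub_le (hnn : ∀ v, 0 ≤ g v) (hg : Integrable g)
    (hg1 : Integrable fun v => |v| * g v) (ξ η : ℝ) :
    ‖FT (fun v => (g v : ℂ)) ξ - FT (fun v => (g v : ℂ)) η‖
      ≤ 2 * π * (∫ v, |v| * g v) * |ξ - η| := by
  rw [FT_eq, FT_eq, ← MeasureTheory.integral_sub (integrable_fourierExp_mul hg ξ)
    (integrable_fourierExp_mul hg η)]
  calc _ ≤ ∫ v, 2 * π * |ξ - η| * (|v| * g v) := by
        refine MeasureTheory.norm_integral_le_of_norm_le (hg1.const_mul _) (ae_of_all _ fun v => ?_)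
        rw [← sub_mul, norm_mul, Complex.norm_real, Real.norm_of_nonneg (hnn v), ← mul_assoc]
        exact mul_le_mul_of_nonneg_right (norm_fourierExp_sub_le ξ η v) (hnn v)
    _ = _ := by rw [MeasureTheory.integral_const_mul]; ring

lemma norm_FT_lt (hnn : ∀ v, 0 ≤ g v) (hg : Integrable g) (hpos : 0 < ∫ v, g v)
    {η : ℝ} (hη : η ≠ 0) : ‖FT (fun v => (g v : ℂ)) η‖ < ∫ v, g v := by
  refine lt_of_le_of_ne (norm_FT_le hnn η) fun heq => ?_
  set z := FT (fun v => (g v : ℂ)) η with hz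
  set α := Complex.arg z
  have hint : Integrable fun v => g v * (1 - cos (-(2 * π * v * η) - α)) := by
    refine hg.mul_bdd (c := 2) (by fun_prop) (ae_of_all _ fun v => ?_)
    rw [Real.norm_eq_abs, abs_le]
    constructor <;>
      linarith [neg_one_le_cos (-(2 * π * v * η) - α), cos_le_one (-(2 * π * v * η) - α)]
  have hre : ∫ v, g v * cos (-(2 * π * v * η) - α) = ∫ v, g v := by
    have h1 : z * Complex.exp (((-α : ℝ) : ℂ) * Complex.I) = ((∫ v, g v : ℝ) : ℂ) := by
      rw [← heq]
      conv_lhs => rw [← Complex.norm_mul_exp_arg_mul_I z, mul_assoc, ← Complex.exp_add]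
      simp [α]
    have h2 := congrArg Complex.re h1
    rw [Complex.ofReal_re, hz, FT_eq, ← MeasureTheory.integral_mul_const] at h2
    rw [← h2]
    rw [← integral_re_eq ((integrable_fourierExp_mul hg η).mul_const _)]
    refine integral_congr_ae (ae_of_all _ fun v => ?_)
    simp only
    rw [mul_right_comm (fourierExp _ _), fourierExp_eq, ← Complex.exp_add, ← add_mul,
      ← Complex.ofReal_add, Complex.re_mul_ofReal, Complex.exp_ofReal_mul_I_re, mul_comm,
      sub_eq_add_neg]
  have hzero : ∫ v, g v * (1 - cos (-(2 * π * v * η) - α)) = 0 := by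
    have : Integrable fun v => g v * cos (-(2 * π * v * η) - α) :=
      hg.mul_bdd (c := 1) (by fun_prop) (ae_of_all _ fun v => by
        rw [Real.norm_eq_abs]; exact abs_cos_le_one _)
    simp only [mul_sub, mul_one]
    rw [MeasureTheory.integral_sub hg this, hre, sub_self]
  rw [integral_eq_zero_iff_of_nonneg
    (fun v => mul_nonneg (hnn v) (by linarith [cos_le_one (-(2 * π * v * η) - α)])) hint] at hzero
  have hcount : {v : ℝ | cos (-(2 * π * v * η) - α) = 1}.Countable := by
    refine (Set.countable_range fun n : ℤ => -(n * (2 * π) + α) / (2 * π * η)).mono ?_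
    intro v hv
    obtain ⟨n, hn⟩ := (cos_eq_one_iff _).1 hv
    refine ⟨n, ?_⟩
    have := pi_pos.ne'
    simp only
    rw [hn]; field_simp; ring
  have hg0 : g =ᵐ[volume] 0 := by
    filter_upwards [hzero, hcount.ae_notMem volume] with v hv hv'
    rcases mul_eq_zero.1 hv with h | h
    · exact h
    · exact absurd (sub_eq_zero.1 h).symm hv'
  rw [integral_congr_ae hg0] at hpos
  simp at hpos

end FourierTransform

/-- The Kac collision operator on the Fourier side (Bobylev's formula). -/
def kacFourier (C₀ s : ℝ) (F : ℝ → ℂ) (ξ : ℝ) : ℂ :=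
  ∫ θ, (kacBeta C₀ s θ : ℂ) * (F (ξ * cos θ) * F (-(ξ * sin θ)) - F ξ * F 0) ∂angleMeasure

lemma norm_bobylev_sub_le {F : ℝ → ℂ} {m L : ℝ} (hm : ∀ ξ, ‖F ξ‖ ≤ m)
    (hL : ∀ ξ η, ‖F ξ - F η‖ ≤ L * |ξ - η|) (ξ : ℝ) {θ : ℝ}
    (hθ : θ ∈ Set.Icc (-(π / 2)) (π / 2)) :
    ‖F (ξ * cos θ) * F (-(ξ * sin θ)) - F ξ * F 0‖ ≤ 2 * m * L * |ξ| * |sin θ| := by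
  have hm0 : 0 ≤ m := (norm_nonneg _).trans (hm 0)
  have hL0 : 0 ≤ L := by simpa using (norm_nonneg _).trans (hL 1 0)
  have e : F (ξ * cos θ) * F (-(ξ * sin θ)) - F ξ * F 0
      = (F (ξ * cos θ) - F ξ) * F (-(ξ * sin θ)) + F ξ * (F (-(ξ * sin θ)) - F 0) := by ring
  have h1 : ‖F (ξ * cos θ) - F ξ‖ ≤ L * (|ξ| * |sin θ|) := by
    refine (hL _ _).trans ?_
    rw [show ξ * cos θ - ξ = ξ * (cos θ - 1) by ring, abs_mul]
    have := one_sub_cos_le_abs_sin hθ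
    gcongr
  have h2 : ‖F (-(ξ * sin θ)) - F 0‖ ≤ L * (|ξ| * |sin θ|) := by
    refine (hL _ _).trans_eq ?_
    rw [sub_zero, abs_neg, abs_mul]
  rw [e]
  calc _ ≤ ‖F (ξ * cos θ) - F ξ‖ * ‖F (-(ξ * sin θ))‖ + ‖F ξ‖ * ‖F (-(ξ * sin θ)) - F 0‖ := by
        refine (norm_add_le _ _).trans_eq ?_
        rw [norm_mul, norm_mul]
    _ ≤ (L * (|ξ| * |sin θ|)) * m + m * (L * (|ξ| * |sin θ|)) := by
        gcongr
        · exact hm _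
        · exact hm _
    _ = _ := by ring

lemma norm_kacFourier_integrand_le {C₀ s : ℝ} (hC₀ : 0 ≤ C₀) {F : ℝ → ℂ} {m L : ℝ}
    (hm : ∀ ξ, ‖F ξ‖ ≤ m) (hL : ∀ ξ η, ‖F ξ - F η‖ ≤ L * |ξ - η|) (ξ : ℝ) {θ : ℝ}
    (hθ : θ ∈ Set.Icc (-(π / 2)) (π / 2)) :
    ‖(kacBeta C₀ s θ : ℂ) * (F (ξ * cos θ) * F (-(ξ * sin θ)) - F ξ * F 0)‖
      ≤ 2 * m * L * |ξ| * (kacBeta C₀ s θ * |sin θ|) := by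
  have hb := kacBeta_nonneg hC₀ s θ
  rw [norm_mul, Complex.norm_real, Real.norm_of_nonneg hb]
  calc _ ≤ kacBeta C₀ s θ * (2 * m * L * |ξ| * |sin θ|) :=
        mul_le_mul_of_nonneg_left (norm_bobylev_sub_le hm hL ξ hθ) hb
    _ = _ := by ring

lemma continuous_of_norm_sub_le {F : ℝ → ℂ} {L : ℝ}
    (hL : ∀ ξ η, ‖F ξ - F η‖ ≤ L * |ξ - η|) : Continuous F := by
  have hL0 : 0 ≤ L := by simpa using (norm_nonneg _).trans (hL 1 0)
  refine (LipschitzWith.of_dist_le_mul (K := ⟨L, hL0⟩) fun x y => ?_).continuous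
  rw [dist_eq_norm, dist_eq_norm]
  exact hL x y

lemma measurable_kacFourier_integrand (C₀ s : ℝ) {F : ℝ → ℂ} (hF : Continuous F) (ξ : ℝ) :
    Measurable fun θ =>
      (kacBeta C₀ s θ : ℂ) * (F (ξ * cos θ) * F (-(ξ * sin θ)) - F ξ * F 0) := by
  refine (Complex.measurable_ofReal.comp (measurable_kacBeta C₀ s)).mul
    (Continuous.measurable ?_)
  fun_prop

lemma integrable_kacFourier_integrand {C₀ s : ℝ} (hC₀ : 0 ≤ C₀) (hs0 : 0 < s) (hs : s < 1 / 2)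
    {F : ℝ → ℂ} {m L : ℝ}
    (hm : ∀ ξ, ‖F ξ‖ ≤ m) (hL : ∀ ξ η, ‖F ξ - F η‖ ≤ L * |ξ - η|) (ξ : ℝ) :
    Integrable (fun θ =>
      (kacBeta C₀ s θ : ℂ) * (F (ξ * cos θ) * F (-(ξ * sin θ)) - F ξ * F 0)) angleMeasure := by
  refine ((integrable_kacBeta_mul_abs_sin hC₀ hs0 hs).const_mul (2 * m * L * |ξ|)).mono'
    (measurable_kacFourier_integrand C₀ s (continuous_of_norm_sub_le hL) ξ).aestronglyMeasurable ?_
  filter_upwards [ae_angle_mem] with θ hθ using norm_kacFourier_integrand_le hC₀ hm hL ξ hθ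

lemma norm_kacFourier_le {C₀ s : ℝ} (hC₀ : 0 ≤ C₀) (hs0 : 0 < s) (hs : s < 1 / 2)
    {F : ℝ → ℂ} {m L : ℝ}
    (hm : ∀ ξ, ‖F ξ‖ ≤ m) (hL : ∀ ξ η, ‖F ξ - F η‖ ≤ L * |ξ - η|) (ξ : ℝ) :
    ‖kacFourier C₀ s F ξ‖
      ≤ 2 * m * L * |ξ| * ∫ θ, kacBeta C₀ s θ * |sin θ| ∂angleMeasure := by
  rw [← MeasureTheory.integral_const_mul]
  refine MeasureTheory.norm_integral_le_of_norm_le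
    ((integrable_kacBeta_mul_abs_sin hC₀ hs0 hs).const_mul (2 * m * L * |ξ|)) ?_
  filter_upwards [ae_angle_mem] with θ hθ using norm_kacFourier_integrand_le hC₀ hm hL ξ hθ

section Collision

variable {C₀ s : ℝ} {g : ℝ → ℝ}

lemma integrable_collision (hC₀ : 0 ≤ C₀) (hs0 : 0 < s) (hs : s < 1 / 2)
    (hnn : ∀ v, 0 ≤ g v) (hg : Integrable g) (hg1 : Integrable fun v => |v| * g v)
    {φ : ℝ → ℝ} {K : ℝ} (hφ : Continuous φ) (hK : ∀ a b, |φ a - φ b| ≤ K * |a - b|) :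
    Integrable (fun p : (ℝ × ℝ) × ℝ => kacBeta C₀ s p.2 * g p.1.2 * g p.1.1 *
      (φ (p.1.1 * cos p.2 - p.1.2 * sin p.2) - φ p.1.1))
      ((volume.prod volume).prod angleMeasure) := by
  have hK0 : 0 ≤ K := by simpa using (abs_nonneg _).trans (hK 1 0)
  have hmom : Integrable (fun p : ℝ × ℝ => (|p.1| * g p.1) * g p.2 + g p.1 * (|p.2| * g p.2))
      (volume.prod volume) := (hg1.mul_prod hg).add (hg.mul_prod hg1)
  have hdom := (hmom.mul_prod (integrable_kacBeta_mul_abs_sin hC₀ hs0 hs)).const_mul K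
  refine hdom.mono' ?_ ?_
  · have hgg : AEStronglyMeasurable (fun p : (ℝ × ℝ) × ℝ => g p.1.2 * g p.1.1)
        ((volume.prod volume).prod angleMeasure) :=
      (hg.1.comp_snd.mul hg.1.comp_fst).comp_fst
    have hb : Measurable (fun p : (ℝ × ℝ) × ℝ => kacBeta C₀ s p.2) :=
      (measurable_kacBeta C₀ s).comp measurable_snd
    have hd : Continuous (fun p : (ℝ × ℝ) × ℝ =>
      φ (p.1.1 * cos p.2 - p.1.2 * sin p.2) - φ p.1.1) := by fun_prop
    refine ((hb.aestronglyMeasurable.mul hgg).mul hd.aestronglyMeasurable).congr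
      (ae_of_all _ fun p => ?_)
    simp only [Pi.mul_apply, mul_assoc]
  · have hae : ∀ᵐ p : (ℝ × ℝ) × ℝ ∂((volume.prod volume).prod angleMeasure),
        p.2 ∈ Set.Icc (-(π / 2)) (π / 2) :=
      Measure.quasiMeasurePreserving_snd.ae ae_angle_mem
    filter_upwards [hae] with p hp
    have hb := kacBeta_nonneg hC₀ s p.2
    have h1 := hnn p.1.1
    have h2 := hnn p.1.2
    rw [norm_mul, Real.norm_of_nonneg (by positivity), Real.norm_eq_abs]
    have h3 : |φ (p.1.1 * cos p.2 - p.1.2 * sin p.2) - φ p.1.1|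
        ≤ K * ((|p.1.1| + |p.1.2|) * |sin p.2|) := by
      refine (hK _ _).trans (mul_le_mul_of_nonneg_left ?_ hK0)
      rw [show p.1.1 * cos p.2 - p.1.2 * sin p.2 - p.1.1
        = p.1.1 * (cos p.2 - 1) - p.1.2 * sin p.2 by ring]
      refine (abs_sub _ _).trans ?_
      rw [abs_mul, abs_mul, add_mul]
      have := one_sub_cos_le_abs_sin hp
      gcongr
    calc _ ≤ kacBeta C₀ s p.2 * g p.1.2 * g p.1.1 * (K * ((|p.1.1| + |p.1.2|) * |sin p.2|)) := by
          gcongr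
      _ = _ := by ring

lemma integral_collision (hC₀ : 0 ≤ C₀) (hs0 : 0 < s) (hs : s < 1 / 2)
    (hnn : ∀ v, 0 ≤ g v) (hg : Integrable g) (hg1 : Integrable fun v => |v| * g v)
    {φ : ℝ → ℝ} {K : ℝ} (hφ : Continuous φ) (hK : ∀ a b, |φ a - φ b| ≤ K * |a - b|) :
    (∫ v : ℝ, ∫ vs : ℝ, ∫ θ in (-(π / 2))..(π / 2), kacBeta C₀ s θ * g vs * g v *
      (φ (v * cos θ - vs * sin θ) - φ v))
      = ∫ θ, kacBeta C₀ s θ * (∫ p : ℝ × ℝ, g p.2 * g p.1 *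
          (φ (p.1 * cos θ - p.2 * sin θ) - φ p.1)) ∂angleMeasure := by
  have hI := integrable_collision hC₀ hs0 hs hnn hg hg1 hφ hK
  have hpi : -(π / 2) ≤ π / 2 := by linarith [pi_pos]
  simp only [intervalIntegral.integral_of_le hpi]
  have h1 := integral_prod _ hI.integral_prod_left
  have h2 := integral_prod _ hI
  have h3 := integral_prod_symm _ hI
  refine (h1.symm.trans (h2.symm.trans h3)).trans ?_
  refine integral_congr_ae (ae_of_all _ fun θ => ?_)
  simp only [mul_assoc]
  exact MeasureTheory.integral_const_mul _ _

lemma integral_fourierExp_collision (hg : Integrable g) (ξ θ : ℝ) :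
    Integrable (fun p : ℝ × ℝ => ((g p.2 * g p.1 : ℝ) : ℂ) *
      (fourierExp ξ (p.1 * cos θ - p.2 * sin θ) - fourierExp ξ p.1)) ∧
    ∫ p : ℝ × ℝ, ((g p.2 * g p.1 : ℝ) : ℂ) *
      (fourierExp ξ (p.1 * cos θ - p.2 * sin θ) - fourierExp ξ p.1)
    = FT (fun v => (g v : ℂ)) (ξ * cos θ) * FT (fun v => (g v : ℂ)) (-(ξ * sin θ))
      - FT (fun v => (g v : ℂ)) ξ * FT (fun v => (g v : ℂ)) 0 := by
  have hi := fun η => integrable_fourierExp_mul hg η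
  have e : ∀ p : ℝ × ℝ, ((g p.2 * g p.1 : ℝ) : ℂ) *
      (fourierExp ξ (p.1 * cos θ - p.2 * sin θ) - fourierExp ξ p.1)
      = (fourierExp (ξ * cos θ) p.1 * (g p.1 : ℂ)) * (fourierExp (-(ξ * sin θ)) p.2 * (g p.2 : ℂ))
        - (fourierExp ξ p.1 * (g p.1 : ℂ)) * (fourierExp 0 p.2 * (g p.2 : ℂ)) := by
    intro p
    have h1 : fourierExp ξ (p.1 * cos θ - p.2 * sin θ)
        = fourierExp (ξ * cos θ) p.1 * fourierExp (-(ξ * sin θ)) p.2 := by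
      unfold fourierExp
      rw [← Complex.exp_add]; congr 1; push_cast; ring
    have h2 : fourierExp 0 p.2 = 1 := by simp [fourierExp]
    rw [h1, h2]; push_cast; ring
  simp only [e]
  have i1 := (hi (ξ * cos θ)).mul_prod (hi (-(ξ * sin θ)))
  have i2 := (hi ξ).mul_prod (hi 0)
  refine ⟨i1.sub i2, ?_⟩
  refine (MeasureTheory.integral_sub i1 i2).trans ?_
  simp only [FT_eq]
  have hp := fun a b => integral_prod_mul (L := ℂ) (μ := (volume : Measure ℝ))
    (ν := (volume : Measure ℝ)) (fun v => fourierExp a v * (g v : ℂ))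
    (fun v => fourierExp b v * (g v : ℂ))
  exact congrArg₂ (· - ·) (hp _ _) (hp _ _)

lemma collision_cos (hC₀ : 0 ≤ C₀) (hs0 : 0 < s) (hs : s < 1 / 2)
    (hnn : ∀ v, 0 ≤ g v) (hg : Integrable g) (hg1 : Integrable fun v => |v| * g v) (ξ : ℝ) :
    (∫ v : ℝ, ∫ vs : ℝ, ∫ θ in (-(π / 2))..(π / 2), kacBeta C₀ s θ * g vs * g v *
      (cos (2 * π * ξ * (v * cos θ - vs * sin θ)) - cos (2 * π * ξ * v)))
      = (kacFourier C₀ s (FT fun v => (g v : ℂ)) ξ).re := by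
  rw [integral_collision (φ := fun v => cos (2 * π * ξ * v)) (K := |2 * π * ξ|)
    hC₀ hs0 hs hnn hg hg1 (by fun_prop) ?_, kacFourier,
    ← integral_re_eq (integrable_kacFourier_integrand hC₀ hs0 hs (norm_FT_le hnn)
      (norm_FT_sub_le hnn hg hg1) ξ)]
  · refine integral_congr_ae (ae_of_all _ fun θ => ?_)
    obtain ⟨h1, h2⟩ := integral_fourierExp_collision hg ξ θ
    simp only [Complex.re_ofReal_mul]
    rw [← h2, ← integral_re_eq h1]
    simp only [Complex.re_ofReal_mul, Complex.sub_re, fourierExp_re]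
  · intro a b
    refine (abs_cos_sub_cos_le _ _).trans_eq ?_
    rw [← mul_sub, abs_mul]

lemma collision_sin (hC₀ : 0 ≤ C₀) (hs0 : 0 < s) (hs : s < 1 / 2)
    (hnn : ∀ v, 0 ≤ g v) (hg : Integrable g) (hg1 : Integrable fun v => |v| * g v) (ξ : ℝ) :
    (∫ v : ℝ, ∫ vs : ℝ, ∫ θ in (-(π / 2))..(π / 2), kacBeta C₀ s θ * g vs * g v *
      (sin (2 * π * ξ * (v * cos θ - vs * sin θ)) - sin (2 * π * ξ * v)))
      = -(kacFourier C₀ s (FT fun v => (g v : ℂ)) ξ).im := by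
  rw [integral_collision (φ := fun v => sin (2 * π * ξ * v)) (K := |2 * π * ξ|)
    hC₀ hs0 hs hnn hg hg1 (by fun_prop) ?_, kacFourier,
    ← integral_im_eq (integrable_kacFourier_integrand hC₀ hs0 hs (norm_FT_le hnn)
      (norm_FT_sub_le hnn hg hg1) ξ), ← MeasureTheory.integral_neg]
  · refine integral_congr_ae (ae_of_all _ fun θ => ?_)
    obtain ⟨h1, h2⟩ := integral_fourierExp_collision hg ξ θ
    simp only [Complex.im_ofReal_mul]
    rw [← h2, ← integral_im_eq h1, ← mul_neg, ← MeasureTheory.integral_neg]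
    simp only [Complex.im_ofReal_mul, Complex.sub_im, fourierExp_im]
    congr 1
    refine integral_congr_ae (ae_of_all _ fun p => ?_)
    simp only
    ring
  · intro a b
    refine (abs_sin_sub_sin_le _ _).trans_eq ?_
    rw [← mul_sub, abs_mul]

end Collision

/-- The primitive of a bounded function is measurable, even where the integral is a junk value. -/
lemma measurable_of_eq_add_integral {G q : ℝ → ℝ} {G₀ B : ℝ} (hB : 0 ≤ B) (hq : ∀ τ, |q τ| ≤ B)
    (hG : ∀ t, G t = G₀ + ∫ τ in (0 : ℝ)..max t 0, q τ) : Measurable G := by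
  classical
  set S : Set ℝ := {t | IntervalIntegrable q volume 0 (max t 0)} with hS
  have hSm : MeasurableSet S := by
    refine Set.OrdConnected.measurableSet ⟨fun x _ y hy z hz => ?_⟩
    refine IntervalIntegrable.mono_set (b := max y 0) hy ?_
    rw [Set.uIcc_of_le (le_max_right _ _), Set.uIcc_of_le (le_max_right _ _)]
    exact Set.Icc_subset_Icc_right (max_le_max_right 0 hz.2)
  have hc : ContinuousOn G S := by
    refine (LipschitzOnWith.of_dist_le_mul (K := ⟨B, hB⟩) fun x hx y hy => ?_).continuousOn
    rw [dist_eq_norm, dist_eq_norm, hG x, hG y, add_sub_add_left_eq_sub,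
      integral_interval_sub_left hx hy]
    refine (intervalIntegral.norm_integral_le_of_norm_le_const fun τ _ => hq τ).trans ?_
    exact mul_le_mul_of_nonneg_left (abs_max_sub_max_le_abs x y 0) hB
  have e : G = S.piecewise G fun _ => G₀ := by
    funext t
    by_cases ht : t ∈ S
    · simp [ht]
    · rw [Set.piecewise_eq_of_notMem _ _ _ ht, hG t, integral_undef ht, add_zero]
  rw [e]
  exact hc.measurable_piecewise continuousOn_const hSm

section Evolution

variable {C₀ s m L : ℝ} {F : ℝ → ℝ → ℂ}

lemma measurable_uncurry_of_weak (hC₀ : 0 ≤ C₀) (hs0 : 0 < s) (hs : s < 1 / 2)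
    (hm : ∀ t ξ, ‖F t ξ‖ ≤ m) (hL : ∀ t ξ η, ‖F t ξ - F t η‖ ≤ L * |ξ - η|)
    (hre : ∀ ξ t, (F t ξ).re
      = (F 0 ξ).re + ∫ τ in (0 : ℝ)..max t 0, (kacFourier C₀ s (F τ) ξ).re)
    (him : ∀ ξ t, (F t ξ).im
      = (F 0 ξ).im + ∫ τ in (0 : ℝ)..max t 0, (kacFourier C₀ s (F τ) ξ).im) :
    Measurable (Function.uncurry F) := by
  have hb := fun τ ξ => norm_kacFourier_le hC₀ hs0 hs (hm τ) (hL τ) ξ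
  have h1 : ∀ ξ, Measurable fun t => F t ξ := by
    intro ξ
    have hB := (norm_nonneg _).trans (hb 0 ξ)
    have r := measurable_of_eq_add_integral hB
      (fun τ => (Complex.abs_re_le_norm _).trans (hb τ ξ)) (hre ξ)
    have i := measurable_of_eq_add_integral hB
      (fun τ => (Complex.abs_im_le_norm _).trans (hb τ ξ)) (him ξ)
    have := (Complex.measurable_ofReal.comp r).add
      ((Complex.measurable_ofReal.comp i).mul_const Complex.I)
    exact (funext fun t => (Complex.re_add_im (F t ξ)).symm :
      (fun t => F t ξ) = fun t => ((F t ξ).re : ℂ) + (F t ξ).im * Complex.I) ▸ this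
  have h2 : Measurable (Function.uncurry fun ξ t => F t ξ) :=
    measurable_uncurry_of_continuous_of_measurable
      (fun t => continuous_of_norm_sub_le (hL t)) h1
  exact h2.comp measurable_swap

lemma intervalIntegrable_kacFourier (hC₀ : 0 ≤ C₀) (hs0 : 0 < s) (hs : s < 1 / 2)
    (hm : ∀ t ξ, ‖F t ξ‖ ≤ m) (hL : ∀ t ξ η, ‖F t ξ - F t η‖ ≤ L * |ξ - η|)
    (hF : Measurable (Function.uncurry F)) (ξ a b : ℝ) :
    IntervalIntegrable (fun τ => kacFourier C₀ s (F τ) ξ) volume a b := by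
  have hmeas : StronglyMeasurable fun τ => kacFourier C₀ s (F τ) ξ := by
    unfold kacFourier
    refine StronglyMeasurable.integral_prod_right (f := fun τ θ => (kacBeta C₀ s θ : ℂ) *
      (F τ (ξ * cos θ) * F τ (-(ξ * sin θ)) - F τ ξ * F τ 0)) ?_
    refine Measurable.stronglyMeasurable ?_
    have hA : ∀ c : ℝ → ℝ, Measurable c → Measurable fun p : ℝ × ℝ => F p.1 (c p.2) :=
      fun c hc => hF.comp (measurable_fst.prodMk (hc.comp measurable_snd))
    have hb : Measurable fun p : ℝ × ℝ => (kacBeta C₀ s p.2 : ℂ) :=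
      Complex.measurable_ofReal.comp ((measurable_kacBeta C₀ s).comp measurable_snd)
    exact hb.mul (((hA (fun θ => ξ * cos θ) (by fun_prop)).mul
      (hA (fun θ => -(ξ * sin θ)) (by fun_prop))).sub
      ((hA (fun _ => ξ) measurable_const).mul (hA (fun _ => 0) measurable_const)))
  rw [intervalIntegrable_iff]
  refine Measure.integrableOn_of_bounded (by simp) hmeas.aestronglyMeasurable
    (ae_of_all _ fun τ => norm_kacFourier_le hC₀ hs0 hs (hm τ) (hL τ) ξ)

/-- The Fourier transform of a weak solution is a classical solution of Bobylev's equation. -/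
lemma continuous_and_hasDerivAt_of_weak (hC₀ : 0 ≤ C₀) (hs0 : 0 < s) (hs : s < 1 / 2)
    (hm : ∀ t ξ, ‖F t ξ‖ ≤ m) (hL : ∀ t ξ η, ‖F t ξ - F t η‖ ≤ L * |ξ - η|)
    (hre : ∀ ξ t, (F t ξ).re
      = (F 0 ξ).re + ∫ τ in (0 : ℝ)..max t 0, (kacFourier C₀ s (F τ) ξ).re)
    (him : ∀ ξ t, (F t ξ).im
      = (F 0 ξ).im + ∫ τ in (0 : ℝ)..max t 0, (kacFourier C₀ s (F τ) ξ).im) :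
    (∀ ξ, Continuous fun t => F t ξ) ∧
    ∀ ξ t, 0 < t → HasDerivAt (fun t => F t ξ) (kacFourier C₀ s (F t) ξ) t := by
  have hF := measurable_uncurry_of_weak hC₀ hs0 hs hm hL hre him
  have hI := intervalIntegrable_kacFourier hC₀ hs0 hs hm hL hF
  have heq : ∀ ξ t, F t ξ = F 0 ξ + ∫ τ in (0 : ℝ)..max t 0, kacFourier C₀ s (F τ) ξ := by
    intro ξ t
    have hi := hI ξ 0 (max t 0)
    have r : ∫ τ in (0 : ℝ)..max t 0, (kacFourier C₀ s (F τ) ξ).re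
        = (∫ τ in (0 : ℝ)..max t 0, kacFourier C₀ s (F τ) ξ).re :=
      Complex.reCLM.intervalIntegral_comp_comm hi
    have i : ∫ τ in (0 : ℝ)..max t 0, (kacFourier C₀ s (F τ) ξ).im
        = (∫ τ in (0 : ℝ)..max t 0, kacFourier C₀ s (F τ) ξ).im :=
      Complex.imCLM.intervalIntegral_comp_comm hi
    apply Complex.ext
    · rw [hre ξ t, r, Complex.add_re]
    · rw [him ξ t, i, Complex.add_im]
  have hcont : ∀ ξ, Continuous fun t => F t ξ := by
    intro ξ
    rw [funext (heq ξ)]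
    exact continuous_const.add
      ((continuous_primitive (hI ξ) 0).comp (continuous_id.max continuous_const))
  refine ⟨hcont, fun ξ t ht => ?_⟩
  have hKc : Continuous fun τ => kacFourier C₀ s (F τ) ξ := by
    refine continuous_of_dominated
      (bound := fun θ => 2 * m * L * |ξ| * (kacBeta C₀ s θ * |sin θ|)) (fun τ => ?_) (fun τ => ?_)
      ((integrable_kacBeta_mul_abs_sin hC₀ hs0 hs).const_mul _) (ae_of_all _ fun θ => ?_)
    · exact (measurable_kacFourier_integrand C₀ s
        (continuous_of_norm_sub_le (hL τ)) ξ).aestronglyMeasurable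
    · filter_upwards [ae_angle_mem] with θ hθ using
        norm_kacFourier_integrand_le hC₀ (hm τ) (hL τ) ξ hθ
    · exact continuous_const.mul (((hcont _).mul (hcont _)).sub ((hcont _).mul (hcont _)))
  have hd := (hKc.integral_hasStrictDerivAt 0 t).hasDerivAt.const_add (F 0 ξ)
  refine hd.congr_of_eventuallyEq ?_
  filter_upwards [lt_mem_nhds ht] with u hu
  rw [heq ξ u, max_eq_left hu.le]

lemma continuous_uncurry_of_lipschitz (hL : ∀ t ξ η, ‖F t ξ - F t η‖ ≤ L * |ξ - η|)
    (hc : ∀ ξ, Continuous fun t => F t ξ) : Continuous (Function.uncurry F) := by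
  have hL0 : 0 ≤ L := by simpa using (norm_nonneg _).trans (hL 0 1 0)
  exact continuous_prod_of_continuous_lipschitzWith' (Function.uncurry F) ⟨L, hL0⟩
    (fun t => LipschitzWith.of_dist_le_mul fun x y => by
      rw [dist_eq_norm, dist_eq_norm]; exact hL t x y) hc

end Evolution

lemma one_add_pow_le_one_add_two_pow_mul {y : ℝ} (h0 : 0 ≤ y) (h1 : y ≤ 1) (N : ℕ) :
    (1 + y) ^ N ≤ 1 + 2 ^ N * y := by
  suffices h : (1 + y) ^ N ≤ 1 + (2 ^ N - 1) * y by linarith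
  induction N with
  | zero => simp
  | succ k ih =>
    have hk : (1 : ℝ) ≤ 2 ^ k := one_le_pow₀ (by norm_num)
    have hy2 : (2 ^ k - 1) * y ^ 2 ≤ (2 ^ k - 1) * y :=
      mul_le_mul_of_nonneg_left (by nlinarith) (by linarith)
    calc (1 + y) ^ (k + 1) = (1 + y) ^ k * (1 + y) := pow_succ _ _
      _ ≤ (1 + (2 ^ k - 1) * y) * (1 + y) := by gcongr
      _ = 1 + 2 ^ k * y + (2 ^ k - 1) * y ^ 2 := by ring
      _ ≤ 1 + 2 ^ k * y + (2 ^ k - 1) * y := by gcongr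
      _ = 1 + (2 ^ (k + 1) - 1) * y := by ring

/-- The angles for which `x sin θ` has moderate size, away from `±π/2`. -/
def moderateAngles (x : ℝ) : Set ℝ := {θ | 1 ≤ |x * sin θ| ∧ |x * sin θ| ≤ 2 ∧ sin θ ^ 2 ≤ 1 / 2}

lemma measurableSet_moderateAngles (x : ℝ) : MeasurableSet (moderateAngles x) := by
  have h : Measurable fun θ => |x * sin θ| := by fun_prop
  exact (measurableSet_le measurable_const h).inter ((measurableSet_le h measurable_const).inter
    (measurableSet_le (by fun_prop : Measurable fun θ => sin θ ^ 2) measurable_const))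

lemma integrable_indicator_moderateAngles {C₀ s : ℝ} (hC₀ : 0 ≤ C₀) (hs0 : 0 < s) (hs : s < 1 / 2)
    (x : ℝ) : Integrable ((moderateAngles x).indicator (kacBeta C₀ s)) angleMeasure := by
  refine ((integrable_kacBeta_mul_abs_sin hC₀ hs0 hs).const_mul |x|).mono'
    ((measurable_kacBeta C₀ s).indicator (measurableSet_moderateAngles x)).aestronglyMeasurable
    (ae_of_all _ fun θ => ?_)
  have hb := kacBeta_nonneg hC₀ s θ
  by_cases hθ : θ ∈ moderateAngles x
  · rw [Set.indicator_of_mem hθ, Real.norm_of_nonneg hb]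
    have := hθ.1
    rw [abs_mul] at this
    nlinarith
  · rw [Set.indicator_of_notMem hθ, norm_zero]
    positivity

/-- The singularity of the cross-section yields coercivity of order `2s`. -/
lemma exists_le_integral_moderateAngles {C₀ s : ℝ} (hC₀ : 0 < C₀) (hs0 : 0 < s) (hs : s < 1 / 2) :
    ∃ δ > 0, ∃ E, ∀ x : ℝ, δ * (1 + x ^ 2) ^ s - E
      ≤ ∫ θ, (moderateAngles x).indicator (kacBeta C₀ s) θ ∂angleMeasure := by
  set d := C₀ * (1 / 2) / 2 ^ (1 + 2 * s) * (2 - π / 2) with hd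
  have hpi := pi_lt_d2
  have hpi3 := pi_gt_three
  have hd0 : 0 < d := by
    have : 0 < 2 - π / 2 := by linarith
    positivity
  have hnn : ∀ x, 0 ≤ ∫ θ, (moderateAngles x).indicator (kacBeta C₀ s) θ ∂angleMeasure := fun x =>
    integral_nonneg fun θ => Set.indicator_nonneg (fun θ _ => kacBeta_nonneg hC₀.le s θ) θ
  have key : ∀ x : ℝ, 4 ≤ |x| → d * |x| ^ (2 * s)
      ≤ ∫ θ, (moderateAngles x).indicator (kacBeta C₀ s) θ ∂angleMeasure := by
    intro x hx
    have hx0 : 0 < |x| := by linarith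
    set I := Set.Icc (π / (2 * |x|)) (2 / |x|) with hI
    have hsub : ∀ θ ∈ I, θ ∈ moderateAngles x ∧ θ ∈ Set.Ioc (-(π / 2)) (π / 2) ∧
        C₀ * (1 / 2) / (2 / |x|) ^ (1 + 2 * s) ≤ kacBeta C₀ s θ := by
      intro θ hθ
      have hθ0 : 0 < θ := lt_of_lt_of_le (by positivity) hθ.1
      have hθ1 : θ ≤ 1 / 2 := hθ.2.trans (by rw [div_le_div_iff₀ hx0 (by norm_num)]; linarith)
      have hlo : 2 / π * θ ≤ sin θ := mul_le_sin hθ0.le (by linarith)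
      have hhi : sin θ ≤ θ := sin_le hθ0.le
      have hsin0 : 0 < sin θ := lt_of_lt_of_le (by positivity) hlo
      have hx1 : |x| * θ ≤ 2 := by
        have := hθ.2; rw [le_div_iff₀ hx0] at this; linarith
      have hx2 : 1 ≤ |x| * sin θ := by
        have h1 := hθ.1
        rw [div_le_iff₀ (by positivity)] at h1
        calc (1 : ℝ) = 2 / π * (π / 2) := by field_simp
          _ ≤ 2 / π * (|x| * θ) := by gcongr; linarith
          _ = |x| * (2 / π * θ) := by ring
          _ ≤ _ := by gcongr
      have hsq : sin θ ^ 2 ≤ 1 / 2 := by nlinarith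
      have hcos : 1 / 2 ≤ cos θ := by
        have := one_sub_sq_div_two_le_cos (x := θ)
        nlinarith
      refine ⟨⟨?_, ?_, hsq⟩, ⟨by linarith, by linarith⟩, ?_⟩
      · rw [abs_mul, abs_of_pos hsin0]; exact hx2
      · rw [abs_mul, abs_of_pos hsin0]
        exact (mul_le_mul_of_nonneg_left hhi hx0.le).trans hx1
      · unfold kacBeta
        rw [abs_of_pos hsin0, abs_of_nonneg (by linarith : 0 ≤ cos θ)]
        gcongr
        exact hhi.trans hθ.2
    calc d * |x| ^ (2 * s)
        = C₀ * (1 / 2) / (2 / |x|) ^ (1 + 2 * s) * volume.real I := by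
          rw [hI, Real.volume_real_Icc_of_le (by
            rw [div_le_div_iff₀ (by positivity) hx0]; nlinarith), div_rpow (by norm_num) hx0.le,
            rpow_add hx0, rpow_one, hd]
          field_simp
      _ = ∫ θ in I, C₀ * (1 / 2) / (2 / |x|) ^ (1 + 2 * s) := by
          rw [setIntegral_const, smul_eq_mul, mul_comm]
      _ ≤ ∫ θ in I, (moderateAngles x).indicator (kacBeta C₀ s) θ ∂angleMeasure := by
          have hrest : angleMeasure.restrict I = volume.restrict I := by
            unfold angleMeasure
            rw [Measure.restrict_restrict measurableSet_Icc,
              Set.inter_eq_left.2 fun θ hθ => (hsub θ hθ).2.1]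
          have hint := (integrable_indicator_moderateAngles hC₀.le hs0 hs x).integrableOn (s := I)
          rw [IntegrableOn, hrest] at hint
          rw [hrest]
          refine setIntegral_mono_on (integrableOn_const (by simp [hI])) hint measurableSet_Icc
            fun θ hθ => ?_
          rw [Set.indicator_of_mem (hsub θ hθ).1]
          exact (hsub θ hθ).2.2
      _ ≤ _ := setIntegral_le_integral (integrable_indicator_moderateAngles hC₀.le hs0 hs x)
          (ae_of_all _ fun θ => Set.indicator_nonneg (fun θ _ => kacBeta_nonneg hC₀.le s θ) θ)
  refine ⟨d / 2, by positivity, d / 2 * 17 ^ s, fun x => ?_⟩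
  rcases le_or_gt 4 |x| with hx | hx
  · refine le_trans ?_ (key x hx)
    have h1 : (1 + x ^ 2) ^ s ≤ 2 * |x| ^ (2 * s) := by
      have hx2 : (4 : ℝ) ^ 2 ≤ x ^ 2 := by rw [← sq_abs x]; gcongr
      calc (1 + x ^ 2) ^ s ≤ (2 * x ^ 2) ^ s := by gcongr; linarith
        _ = 2 ^ s * (x ^ 2) ^ s := mul_rpow (by norm_num) (sq_nonneg x)
        _ ≤ 2 ^ (1 : ℝ) * (x ^ 2) ^ s := by gcongr <;> linarith
        _ = 2 * |x| ^ (2 * s) := by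
          rw [rpow_one, ← sq_abs, ← rpow_natCast, ← rpow_mul (abs_nonneg x)]; norm_num
    have h2 : 0 ≤ d / 2 * (17 : ℝ) ^ s := by positivity
    nlinarith
  · refine le_trans ?_ (hnn x)
    have : (1 + x ^ 2) ^ s ≤ 17 ^ s := by
      gcongr
      rw [← sq_abs]
      nlinarith [abs_nonneg x]
    nlinarith

lemma exists_mul_log_sub_le {D s κ : ℝ} (hD : 0 < D) (hs : 0 < s) (hκ : 0 ≤ κ) :
    ∃ C, ∀ y : ℝ, 1 ≤ y → κ * log y - D * y ^ s ≤ C := by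
  set l := D * s / (κ + 1) with hl
  have hl0 : 0 < l := by positivity
  refine ⟨-(κ / s * log l), fun y hy => ?_⟩
  have hy0 : 0 < y := by linarith
  have hz : 0 < y ^ s := rpow_pos_of_pos hy0 s
  have h1 : log l + s * log y ≤ l * y ^ s := by
    rw [← log_rpow hy0, ← log_mul hl0.ne' hz.ne']
    linarith [log_le_sub_one_of_pos (mul_pos hl0 hz)]
  have h2 : κ / s * (log l + s * log y) ≤ κ / s * (l * y ^ s) := by gcongr
  have h3 : κ / s * (l * y ^ s) ≤ D * y ^ s := by
    rw [← mul_assoc]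
    gcongr
    rw [hl, div_mul_div_comm, div_le_iff₀ (by positivity)]
    nlinarith [mul_pos hD hs]
  have h4 : κ / s * (log l + s * log y) = κ / s * log l + κ * log y := by field_simp
  linarith

lemma bobylev_pointwise_le {m c : ℝ} {a : ℝ → ℂ} (hm : ∀ ξ, ‖a ξ‖ ≤ m)
    (hc : ∀ η, 1 ≤ |η| → |η| ≤ 2 → ‖a η‖ ≤ m - c) {N : ℕ} {p x : ℝ} (hp0 : 0 ≤ p) (hpN : p ≤ N)
    (hmax : ∀ y, |y| ≤ |x| → ‖a y‖ ≤ ‖a x‖ * ((1 + x ^ 2) / (1 + y ^ 2)) ^ p) (θ : ℝ) :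
    ‖a (x * cos θ)‖ * ‖a (-(x * sin θ))‖ - ‖a x‖ * m
      ≤ ‖a x‖ * (m * 2 ^ (N + 1) * sin θ ^ 2 - (moderateAngles x).indicator (fun _ => c) θ) := by
  have hm0 : 0 ≤ m := (norm_nonneg _).trans (hm 0)
  have hax := norm_nonneg (a x)
  have hsc := sin_sq_add_cos_sq θ
  have hratio : ∀ (q : ℝ) (y : ℝ), 1 ≤ q → 1 + x ^ 2 ≤ q * (1 + y ^ 2) → |y| ≤ |x| →
      ‖a y‖ ≤ ‖a x‖ * q ^ N := by
    intro q y hq h hy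
    refine (hmax y hy).trans (mul_le_mul_of_nonneg_left ?_ hax)
    calc ((1 + x ^ 2) / (1 + y ^ 2)) ^ p ≤ q ^ p := by
          gcongr
          rw [div_le_iff₀ (by positivity)]; exact h
      _ ≤ q ^ (N : ℝ) := rpow_le_rpow_of_exponent_le hq hpN
      _ = q ^ N := rpow_natCast q N
  rcases le_or_gt (sin θ ^ 2) (1 / 2) with hθ | hθ
  · have h1 : ‖a (x * cos θ)‖ ≤ ‖a x‖ * (1 + 2 ^ (N + 1) * sin θ ^ 2) := by
      refine (hratio (1 + 2 * sin θ ^ 2) _ (by nlinarith [sq_nonneg (sin θ)]) ?_ ?_).trans ?_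
      · have : cos θ ^ 2 = 1 - sin θ ^ 2 := by linarith
        rw [mul_pow, this]
        have := mul_nonneg (sq_nonneg x) (mul_nonneg (sq_nonneg (sin θ))
          (by linarith : 0 ≤ 1 - 2 * sin θ ^ 2))
        nlinarith [sq_nonneg (sin θ)]
      · rw [abs_mul]; exact mul_le_of_le_one_right (abs_nonneg x) (abs_cos_le_one θ)
      · gcongr
        refine (one_add_pow_le_one_add_two_pow_mul (by positivity) (by linarith) N).trans_eq ?_
        ring
    have h2 : ‖a (-(x * sin θ))‖ ≤ m - (moderateAngles x).indicator (fun _ => c) θ := by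
      by_cases hmem : θ ∈ moderateAngles x
      · rw [Set.indicator_of_mem hmem]
        exact hc _ (by rw [abs_neg]; exact hmem.1) (by rw [abs_neg]; exact hmem.2.1)
      · rw [Set.indicator_of_notMem hmem, sub_zero]; exact hm _
    have h3 := hm (-(x * sin θ))
    set n := ‖a (-(x * sin θ))‖
    have hn : 0 ≤ n := norm_nonneg _
    set i := (moderateAngles x).indicator (fun _ => c) θ
    have hk : 0 ≤ (2 : ℝ) ^ (N + 1) * sin θ ^ 2 := by positivity
    set k := (2 : ℝ) ^ (N + 1) * sin θ ^ 2
    calc _ ≤ ‖a x‖ * (1 + k) * n - ‖a x‖ * m := by gcongr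
      _ = ‖a x‖ * (n + k * n - m) := by ring
      _ ≤ ‖a x‖ * ((m - i) + k * m - m) := by gcongr
      _ = _ := by ring
  · have hmem : θ ∉ moderateAngles x := fun h => absurd h.2.2 (not_le.2 hθ)
    rw [Set.indicator_of_notMem hmem, sub_zero]
    have h1 : ‖a (-(x * sin θ))‖ ≤ ‖a x‖ * 2 ^ N := by
      refine hratio 2 _ (by norm_num) ?_ ?_
      · rw [neg_sq, mul_pow]; nlinarith [sq_nonneg x]
      · rw [abs_neg, abs_mul]; exact mul_le_of_le_one_right (abs_nonneg x) (abs_sin_le_one θ)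
    calc _ ≤ m * (‖a x‖ * 2 ^ N) - 0 := by
          gcongr
          · exact hm _
          · positivity
      _ = ‖a x‖ * (m * 2 ^ (N + 1) * (1 / 2)) := by ring
      _ ≤ _ := by gcongr

lemma inner_kacFourier_le {C₀ s : ℝ} (hC₀ : 0 ≤ C₀) (hs0 : 0 < s) (hs : s < 1 / 2)
    {m c L : ℝ} {a : ℝ → ℂ} (hm : ∀ ξ, ‖a ξ‖ ≤ m) (hL : ∀ ξ η, ‖a ξ - a η‖ ≤ L * |ξ - η|)
    (h0 : a 0 = m)
    (hc : ∀ η, 1 ≤ |η| → |η| ≤ 2 → ‖a η‖ ≤ m - c) {N : ℕ} {p x : ℝ} (hp0 : 0 ≤ p) (hpN : p ≤ N)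
    (hmax : ∀ y, |y| ≤ |x| → ‖a y‖ ≤ ‖a x‖ * ((1 + x ^ 2) / (1 + y ^ 2)) ^ p) :
    inner ℝ (a x) (kacFourier C₀ s a x)
      ≤ ‖a x‖ ^ 2 * (m * 2 ^ (N + 1) * (∫ θ, kacBeta C₀ s θ * |sin θ| ∂angleMeasure)
        - c * ∫ θ, (moderateAngles x).indicator (kacBeta C₀ s) θ ∂angleMeasure) := by
  have hm0 : 0 ≤ m := (norm_nonneg _).trans (hm 0)
  have hI := integrable_kacFourier_integrand hC₀ hs0 hs hm hL x
  have hb := (integrable_kacBeta_mul_abs_sin hC₀ hs0 hs).const_mul (m * 2 ^ (N + 1))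
  have hi := (integrable_indicator_moderateAngles hC₀ hs0 hs x).const_mul c
  rw [← MeasureTheory.integral_const_mul, ← MeasureTheory.integral_const_mul,
    ← MeasureTheory.integral_sub hb hi, ← MeasureTheory.integral_const_mul, kacFourier,
    ← integral_inner hI]
  refine integral_mono (hI.const_inner _) ((hb.sub hi).const_mul _) fun θ => ?_
  have hβ := kacBeta_nonneg hC₀ s θ
  have e : inner ℝ (a x) ((kacBeta C₀ s θ : ℂ) * (a (x * cos θ) * a (-(x * sin θ)) - a x * a 0))
      = kacBeta C₀ s θ * (inner ℝ (a x) (a (x * cos θ) * a (-(x * sin θ))) - ‖a x‖ ^ 2 * m) := by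
    rw [← Complex.real_smul, real_inner_smul_right, inner_sub_right, h0, mul_comm (a x) (m : ℂ),
      ← Complex.real_smul, real_inner_smul_right, real_inner_self_eq_norm_sq, mul_comm m]
  have h1 : inner ℝ (a x) (a (x * cos θ) * a (-(x * sin θ)))
      ≤ ‖a x‖ * (‖a (x * cos θ)‖ * ‖a (-(x * sin θ))‖) := by
    refine (real_inner_le_norm _ _).trans_eq ?_
    rw [norm_mul]
  have h2 := bobylev_pointwise_le hm hc hp0 hpN hmax θ
  have h3 : (moderateAngles x).indicator (kacBeta C₀ s) θ * c
      = kacBeta C₀ s θ * (moderateAngles x).indicator (fun _ => c) θ := by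
    by_cases h : θ ∈ moderateAngles x <;> simp [h]
  simp only [e]
  calc _ ≤ kacBeta C₀ s θ * (‖a x‖ * (‖a (x * cos θ)‖ * ‖a (-(x * sin θ))‖ - ‖a x‖ * m)) := by
        refine mul_le_mul_of_nonneg_left ?_ hβ
        linarith
    _ ≤ kacBeta C₀ s θ * (‖a x‖ * (‖a x‖ * (m * 2 ^ (N + 1) * sin θ ^ 2
          - (moderateAngles x).indicator (fun _ => c) θ))) := by gcongr
    _ ≤ kacBeta C₀ s θ * (‖a x‖ * (‖a x‖ * (m * 2 ^ (N + 1) * |sin θ|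
          - (moderateAngles x).indicator (fun _ => c) θ))) := by
        gcongr
        exact sin_sq_le_abs_sin θ
    _ = ‖a x‖ ^ 2 * (m * 2 ^ (N + 1) * (kacBeta C₀ s θ * |sin θ|)
          - kacBeta C₀ s θ * (moderateAngles x).indicator (fun _ => c) θ) := by ring
    _ = _ := by rw [← h3, mul_comm _ c]

section Decay

variable {C₀ s m L : ℝ} {F : ℝ → ℝ → ℂ}

lemma exists_norm_le_sub_of_lt (hF : Continuous (Function.uncurry F))
    (hlt : ∀ t η, η ≠ 0 → ‖F t η‖ < m) (T : ℝ) :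
    ∃ c > 0, ∀ t ∈ Set.Icc 0 T, ∀ η, 1 ≤ |η| → |η| ≤ 2 → ‖F t η‖ ≤ m - c := by
  set K : Set (ℝ × ℝ) := Set.Icc 0 T ×ˢ (Set.Icc (-2) (-1) ∪ Set.Icc 1 2) with hK
  have hKc : IsCompact K := isCompact_Icc.prod (isCompact_Icc.union isCompact_Icc)
  have hmem : ∀ t ∈ Set.Icc 0 T, ∀ η : ℝ, 1 ≤ |η| → |η| ≤ 2 → (t, η) ∈ K := by
    intro t ht η h1 h2
    refine ⟨ht, ?_⟩
    rw [abs_le] at h2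
    rcases le_abs.1 h1 with h | h
    · exact Or.inr ⟨h, h2.2⟩
    · exact Or.inl ⟨h2.1, by linarith⟩
  rcases K.eq_empty_or_nonempty with he | hne
  · refine ⟨1, one_pos, fun t ht η h1 h2 => ?_⟩
    have := hmem t ht η h1 h2
    simp [he] at this
  obtain ⟨p, hp, hmax⟩ := hKc.exists_isMaxOn hne hF.norm.continuousOn
  have hp0 : p.2 ≠ 0 := by
    rcases hp.2 with h | h
    · exact (by linarith [h.2] : p.2 < 0).ne
    · exact (by linarith [h.1] : (0 : ℝ) < p.2).ne'
  refine ⟨m - ‖F p.1 p.2‖, sub_pos.2 (hlt _ _ hp0), fun t ht η h1 h2 => ?_⟩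
  have : ‖F t η‖ ≤ ‖F p.1 p.2‖ := hmax (hmem t ht η h1 h2)
  linarith

lemma hasDerivAt_nonneg_of_le_left {h : ℝ → ℝ} {h' t : ℝ} (ht : 0 < t)
    (hd : HasDerivAt h h' t) (hmax : ∀ u ∈ Set.Icc 0 t, h u ≤ h t) : 0 ≤ h' := by
  refine ge_of_tendsto (hasDerivAt_iff_tendsto_slope_left_right.1 hd).1 ?_
  filter_upwards [Ioo_mem_nhdsLT ht] with u hu
  rw [slope_def_field]
  exact div_nonneg_of_nonpos (by linarith [hmax u ⟨hu.1.le, hu.2.le⟩]) (by linarith [hu.2])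

/-- Solutions of Bobylev's equation decay faster than any power at positive times. -/
theorem exists_norm_le_rpow_of_bobylev (hC₀ : 0 < C₀) (hs0 : 0 < s) (hs : s < 1 / 2)
    (hm0 : 0 < m) (hm : ∀ t ξ, ‖F t ξ‖ ≤ m) (hL : ∀ t ξ η, ‖F t ξ - F t η‖ ≤ L * |ξ - η|)
    (h0 : ∀ t, F t 0 = m) (hlt : ∀ t η, η ≠ 0 → ‖F t η‖ < m)
    (hc : ∀ ξ, Continuous fun t => F t ξ)
    (hd : ∀ ξ t, 0 < t → HasDerivAt (fun t => F t ξ) (kacFourier C₀ s (F t) ξ) t)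
    {T : ℝ} (hT : 0 < T) (N : ℕ) :
    ∃ A, 0 ≤ A ∧ ∀ ξ, ‖F T ξ‖ ≤ A * (1 + ξ ^ 2) ^ (-(N : ℝ)) := by
  have hF := continuous_uncurry_of_lipschitz hL hc
  obtain ⟨c, hc0, hcF⟩ := exists_norm_le_sub_of_lt hF hlt T
  obtain ⟨δ, hδ, E, hE⟩ := exists_le_integral_moderateAngles hC₀ hs0 hs
  set κ := N / T with hκ
  have hκ0 : 0 ≤ κ := by positivity
  obtain ⟨C₁, hC₁⟩ := exists_mul_log_sub_le (mul_pos hc0 hδ) hs0 hκ0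
  set S := ∫ θ, kacBeta C₀ s θ * |sin θ| ∂angleMeasure
  set C := C₁ + m * 2 ^ (N + 1) * S + c * E + 1 with hC
  set l : ℝ → ℝ := fun ξ => log (1 + ξ ^ 2) with hl
  have hpos : ∀ ξ : ℝ, 0 < 1 + ξ ^ 2 := fun ξ => by positivity
  have hlc : Continuous l := Continuous.log (by fun_prop) fun ξ => (hpos ξ).ne'
  set h : ℝ → ℝ → ℝ := fun t ξ => ‖F t ξ‖ ^ 2 * exp (2 * t * (κ * l ξ - C)) with hh
  have hhc : Continuous (Function.uncurry h) := by
    have h1 : Continuous fun p : ℝ × ℝ => ‖F p.1 p.2‖ := hF.norm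
    have h2 : Continuous fun p : ℝ × ℝ => l p.2 := hlc.comp continuous_snd
    change Continuous fun p : ℝ × ℝ => ‖F p.1 p.2‖ ^ 2 * exp (2 * p.1 * (κ * l p.2 - C))
    fun_prop
  have hbound : ∀ ξ, h T ξ ≤ m ^ 2 := by
    intro ξ
    have hKc : IsCompact (Set.Icc 0 T ×ˢ Set.Icc (-|ξ|) |ξ|) := isCompact_Icc.prod isCompact_Icc
    have hmemξ : (T, ξ) ∈ Set.Icc 0 T ×ˢ Set.Icc (-|ξ|) |ξ| :=
      ⟨⟨hT.le, le_rfl⟩, abs_le.1 le_rfl⟩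
    obtain ⟨⟨t, x⟩, ⟨ht, hx⟩, hmax⟩ := hKc.exists_isMaxOn ⟨_, hmemξ⟩ hhc.continuousOn
    simp only at ht hx
    have hmax' : ∀ u ∈ Set.Icc 0 T, ∀ y, |y| ≤ |ξ| → h u y ≤ h t x := fun u hu y hy =>
      hmax (⟨hu, abs_le.1 hy⟩ : (u, y) ∈ Set.Icc 0 T ×ˢ Set.Icc (-|ξ|) |ξ|)
    have hxξ : |x| ≤ |ξ| := abs_le.2 hx
    refine (hmax' T ⟨hT.le, le_rfl⟩ ξ le_rfl).trans ?_
    by_contra! hcon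
    have ht0 : 0 < t := by
      rcases ht.1.eq_or_lt with h | h
      · exfalso
        subst h
        simp only [hh, mul_zero, zero_mul, exp_zero, mul_one] at hcon
        nlinarith [hm 0 x, norm_nonneg (F 0 x)]
      · exact h
    have hFx : 0 < ‖F t x‖ := by
      refine lt_of_le_of_ne (norm_nonneg _) fun h => ?_
      simp only [hh, ← h] at hcon
      nlinarith
    have hcomp : ∀ y, |y| ≤ |x| →
        ‖F t y‖ ≤ ‖F t x‖ * ((1 + x ^ 2) / (1 + y ^ 2)) ^ (t * κ) := by
      intro y hy
      have h1 := hmax' t ht y (hy.trans hxξ)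
      have e : ∀ z, h t z = (‖F t z‖ * exp (t * κ * l z)) ^ 2 * exp (-(2 * t * C)) := by
        intro z
        simp only [hh]
        rw [mul_pow, ← exp_nat_mul, mul_assoc (‖F t z‖ ^ 2), ← exp_add]
        congr 2; push_cast; ring
      rw [e, e] at h1
      have h2 := le_of_sq_le_sq (le_of_mul_le_mul_right h1 (exp_pos _)) (by positivity)
      have h3 : ((1 + x ^ 2) / (1 + y ^ 2)) ^ (t * κ) = exp (t * κ * l x) / exp (t * κ * l y) := by
        rw [rpow_def_of_pos (by positivity), log_div (hpos x).ne' (hpos y).ne', ← exp_sub]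
        congr 1; simp only [hl]; ring
      rw [h3, mul_div_assoc', le_div_iff₀ (exp_pos _)]
      exact h2
    have hpN : t * κ ≤ N := by
      rw [hκ, mul_div_assoc', div_le_iff₀ hT, mul_comm]
      exact mul_le_mul_of_nonneg_left ht.2 (Nat.cast_nonneg N)
    have hin := inner_kacFourier_le hC₀.le hs0 hs (hm t) (hL t) (h0 t) (hcF t ht)
      (by positivity) hpN hcomp
    have hder : HasDerivAt (fun u => h u x)
        (2 * inner ℝ (F t x) (kacFourier C₀ s (F t) x) * exp (2 * t * (κ * l x - C))
          + ‖F t x‖ ^ 2 * (exp (2 * t * (κ * l x - C)) * (2 * (κ * l x - C)))) t := by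
      refine (hd x t ht0).norm_sq.mul (HasDerivAt.exp ?_)
      simpa using ((hasDerivAt_id t).const_mul 2).mul_const (κ * l x - C)
    have hge := hasDerivAt_nonneg_of_le_left ht0 hder fun u hu =>
      hmax' u ⟨hu.1, hu.2.trans ht.2⟩ x hxξ
    have hneg : m * 2 ^ (N + 1) * S
        - c * (∫ θ, (moderateAngles x).indicator (kacBeta C₀ s) θ ∂angleMeasure)
        + (κ * l x - C) < 0 := by
      have h1 := mul_le_mul_of_nonneg_left (hE x) hc0.le
      have h2 := hC₁ (1 + x ^ 2) (by nlinarith [sq_nonneg x])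
      simp only [hl, hC]
      nlinarith
    have hexp := exp_pos (2 * t * (κ * l x - C))
    have hlast : 2 * exp (2 * t * (κ * l x - C)) * (‖F t x‖ ^ 2 * (m * 2 ^ (N + 1) * S
        - c * (∫ θ, (moderateAngles x).indicator (kacBeta C₀ s) θ ∂angleMeasure)
        + (κ * l x - C))) < 0 :=
      mul_neg_of_pos_of_neg (by positivity) (mul_neg_of_pos_of_neg (by positivity) hneg)
    have hin' := mul_le_mul_of_nonneg_left hin (by positivity : 0 ≤ 2 * exp (2 * t * (κ * l x - C)))
    nlinarith
  refine ⟨m * exp (T * C), by positivity, fun ξ => ?_⟩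
  have h1 := hbound ξ
  have e : h T ξ = (‖F T ξ‖ * exp (T * (κ * l ξ - C))) ^ 2 := by
    simp only [hh]
    rw [mul_pow, ← exp_nat_mul]
    congr 2; push_cast; ring
  rw [e] at h1
  have h2 := le_of_sq_le_sq h1 hm0.le
  have h3 : (1 + ξ ^ 2) ^ (-(N : ℝ)) = exp (-(N * l ξ)) := by
    rw [rpow_def_of_pos (hpos ξ)]
    congr 1; simp only [hl]; ring
  have h4 : T * (κ * l ξ - C) = N * l ξ - T * C := by
    rw [hκ]; field_simp
  rw [h4] at h2
  rw [h3, mul_assoc, ← exp_add, ← sub_eq_add_neg, ← neg_sub, exp_neg, ← div_eq_mul_inv,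
    le_div_iff₀ (exp_pos _)]
  exact h2

end Decay

lemma one_le_jap (v : ℝ) : 1 ≤ jap v :=
  Real.one_le_sqrt.2 (by nlinarith [sq_nonneg v])

lemma abs_le_jap (v : ℝ) : |v| ≤ jap v :=
  Real.abs_le_sqrt (by linarith)

lemma jap_sq (v : ℝ) : jap v ^ 2 = 1 + v ^ 2 :=
  Real.sq_sqrt (by positivity)

lemma continuous_jap : Continuous jap := by
  unfold jap; fun_prop

section Moments

variable {p C : ℝ} {g φ : ℝ → ℝ}

lemma continuous_jap_rpow (p : ℝ) : Continuous fun v => jap v ^ p :=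
  continuous_jap.rpow_const fun v => Or.inl (one_pos.trans_le (one_le_jap v)).ne'

lemma integrable_mul_of_abs_le_jap_rpow (hg : Integrable fun v => jap v ^ p * g v)
    (hφ : Continuous φ) (h : ∀ v, |φ v| ≤ C * jap v ^ p) :
    Integrable fun v => φ v * g v := by
  have hpos : ∀ v, 0 < jap v ^ p := fun v => rpow_pos_of_pos (one_pos.trans_le (one_le_jap v)) _
  have e : (fun v => φ v * g v) = fun v => (φ v / jap v ^ p) * (jap v ^ p * g v) := by
    ext v
    have := (hpos v).ne'
    field_simp
  rw [e]
  refine hg.bdd_mul (c := C)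
    (hφ.div (continuous_jap_rpow p) fun v => (hpos v).ne').aestronglyMeasurable
    (Filter.Eventually.of_forall fun v => ?_)
  rw [norm_eq_abs, abs_div, abs_of_pos (hpos v), div_le_iff₀ (hpos v)]
  exact h v

end Moments

lemma abs_two_mul_cos_sub_two_add_sq_le {s : ℝ} (hs0 : 0 ≤ s) (hs : s ≤ 1) (y : ℝ) :
    |2 * cos y - 2 + y ^ 2| ≤ |y| ^ (2 + 2 * s) := by
  rw [abs_of_nonneg (by linarith [one_sub_sq_div_two_le_cos (x := y)])]
  rcases le_total |y| 1 with h | h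
  · have h1 := (abs_le.1 (cos_bound h)).2
    have h2 : |y| ^ (4 : ℝ) ≤ |y| ^ (2 + 2 * s) :=
      rpow_le_rpow_of_exponent_ge_of_imp (abs_nonneg y) h (by linarith) fun _ h => by linarith
    have h3 : |y| ^ (4 : ℝ) = |y| ^ 4 := by exact_mod_cast rpow_natCast |y| 4
    have h4 : 0 ≤ |y| ^ 4 := by positivity
    rw [h3] at h2
    refine le_trans ?_ h2
    linarith
  · have h2 : |y| ^ (2 : ℝ) ≤ |y| ^ (2 + 2 * s) :=
      rpow_le_rpow_of_exponent_le h (by linarith)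
    have h3 : |y| ^ (2 : ℝ) = y ^ 2 := by rw [← sq_abs]; exact_mod_cast rpow_natCast |y| 2
    linarith [cos_le_one y]

lemma fourierExp_add_add_fourierExp_sub (ξ h v : ℝ) :
    fourierExp (ξ + h) v + fourierExp (ξ - h) v
      = ((2 * cos (2 * π * h * v) : ℝ) : ℂ) * fourierExp ξ v := by
  apply Complex.ext
  · rw [Complex.re_ofReal_mul, Complex.add_re, fourierExp_re, fourierExp_re, fourierExp_re,
      show 2 * π * (ξ + h) * v = 2 * π * ξ * v + 2 * π * h * v by ring,
      show 2 * π * (ξ - h) * v = 2 * π * ξ * v - 2 * π * h * v by ring, cos_add, cos_sub]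
    ring
  · rw [Complex.im_ofReal_mul, Complex.add_im, fourierExp_im, fourierExp_im, fourierExp_im,
      show 2 * π * (ξ + h) * v = 2 * π * ξ * v + 2 * π * h * v by ring,
      show 2 * π * (ξ - h) * v = 2 * π * ξ * v - 2 * π * h * v by ring, sin_add, sin_sub]
    ring

section SecondDifference

variable {s : ℝ} {g : ℝ → ℝ}

/-- The second moment transform is controlled by a second difference of the transform. -/
lemma norm_FT_sq_mul_le (hs0 : 0 ≤ s) (hs : s ≤ 1) (hnn : ∀ v, 0 ≤ g v) (hg : Integrable g)
    (hg2 : Integrable fun v => v ^ 2 * g v) (hgp : Integrable fun v => |v| ^ (2 + 2 * s) * g v)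
    (ξ : ℝ) {h : ℝ} (hh : 0 < h) :
    (2 * π * h) ^ 2 * ‖FT (fun v => ((v ^ 2 * g v : ℝ) : ℂ)) ξ‖
      ≤ ‖FT (fun v => (g v : ℂ)) (ξ + h)‖ + ‖FT (fun v => (g v : ℂ)) (ξ - h)‖
        + 2 * ‖FT (fun v => (g v : ℂ)) ξ‖
        + (2 * π * h) ^ (2 + 2 * s) * ∫ v, |v| ^ (2 + 2 * s) * g v := by
  set F := FT fun v => (g v : ℂ) with hF
  set H := FT fun v => ((v ^ 2 * g v : ℝ) : ℂ) with hH
  have key : F (ξ + h) + F (ξ - h) - 2 * F ξ + ((2 * π * h) ^ 2 : ℝ) * H ξ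
      = ∫ v, fourierExp ξ v
          * (((2 * cos (2 * π * h * v) - 2 + (2 * π * h * v) ^ 2) * g v : ℝ) : ℂ) := by
    have i1 := integrable_fourierExp_mul hg (ξ + h)
    have i2 := integrable_fourierExp_mul hg (ξ - h)
    have i3 := (integrable_fourierExp_mul hg ξ).const_mul 2
    have i4 := (integrable_fourierExp_mul hg2 ξ).const_mul (((2 * π * h) ^ 2 : ℝ) : ℂ)
    have i12 := i1.add i2
    have i123 := i12.sub i3
    rw [hF, hH, FT_eq, FT_eq, FT_eq, FT_eq, ← MeasureTheory.integral_const_mul,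
      ← MeasureTheory.integral_const_mul, ← integral_add' i1 i2, ← integral_sub' i12 i3,
      ← integral_add' i123 i4]
    refine integral_congr_ae (Filter.Eventually.of_forall fun v => ?_)
    have := fourierExp_add_add_fourierExp_sub ξ h v
    simp only [Pi.add_apply, Pi.sub_apply, ← add_mul, this]
    push_cast
    ring
  have hbd : ‖∫ v, fourierExp ξ v
      * (((2 * cos (2 * π * h * v) - 2 + (2 * π * h * v) ^ 2) * g v : ℝ) : ℂ)‖
      ≤ (2 * π * h) ^ (2 + 2 * s) * ∫ v, |v| ^ (2 + 2 * s) * g v := by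
    rw [← MeasureTheory.integral_const_mul]
    refine MeasureTheory.norm_integral_le_of_norm_le (hgp.const_mul _)
      (Filter.Eventually.of_forall fun v => ?_)
    rw [norm_mul, norm_fourierExp, one_mul, Complex.norm_real, norm_mul, norm_eq_abs, norm_eq_abs,
      abs_of_nonneg (hnn v), ← mul_assoc]
    refine mul_le_mul_of_nonneg_right ?_ (hnn v)
    refine (abs_two_mul_cos_sub_two_add_sq_le hs0 hs _).trans_eq ?_
    rw [abs_mul, abs_of_pos (by positivity : 0 < 2 * π * h),
      mul_rpow (by positivity) (abs_nonneg v)]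
  rw [← key] at hbd
  have e : (((2 * π * h) ^ 2 : ℝ) : ℂ) * H ξ
      = (F (ξ + h) + F (ξ - h) - 2 * F ξ + ((2 * π * h) ^ 2 : ℝ) * H ξ)
        - (F (ξ + h) + F (ξ - h) - 2 * F ξ) := by ring
  have hn : (2 * π * h) ^ 2 * ‖H ξ‖ = ‖(((2 * π * h) ^ 2 : ℝ) : ℂ) * H ξ‖ := by
    rw [norm_mul, Complex.norm_real, norm_of_nonneg (by positivity)]
  rw [hn, e]
  refine (norm_sub_le _ _).trans ?_
  have h1 := norm_sub_le (F (ξ + h) + F (ξ - h)) (2 * F ξ)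
  have h2 := norm_add_le (F (ξ + h)) (F (ξ - h))
  have h3 : ‖2 * F ξ‖ = 2 * ‖F ξ‖ := by simp
  linarith

lemma one_add_sq_rpow_neg_le {ξ η : ℝ} (h : |η - ξ| ≤ 1) (N : ℕ) :
    (1 + η ^ 2) ^ (-(N : ℝ)) ≤ 3 ^ N * (1 + ξ ^ 2) ^ (-(N : ℝ)) := by
  have h1 : 1 + ξ ^ 2 ≤ 3 * (1 + η ^ 2) := by
    have := (sq_le_one_iff_abs_le_one (η - ξ)).2 h
    nlinarith [sq_nonneg (2 * η - ξ)]
  have h2 : 0 < 1 + ξ ^ 2 := by positivity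
  have h3 : 0 < 1 + η ^ 2 := by positivity
  rw [rpow_neg h3.le, rpow_neg h2.le, rpow_natCast, rpow_natCast, ← div_eq_mul_inv,
    inv_eq_one_div, div_le_div_iff₀ (by positivity) (by positivity), one_mul, ← mul_pow]
  exact pow_le_pow_left₀ h2.le h1 N

/-- Rapid decay of the transform passes to the second moment. -/
lemma exists_norm_FT_sq_mul_le (hs0 : 0 < s) (hs : s ≤ 1) (hnn : ∀ v, 0 ≤ g v)
    (hg : Integrable g) (hg2 : Integrable fun v => v ^ 2 * g v)
    (hgp : Integrable fun v => |v| ^ (2 + 2 * s) * g v)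
    (hdec : ∀ N : ℕ, ∃ A, 0 ≤ A ∧
      ∀ ξ, ‖FT (fun v => (g v : ℂ)) ξ‖ ≤ A * (1 + ξ ^ 2) ^ (-(N : ℝ))) (K : ℕ) :
    ∃ A, 0 ≤ A ∧
      ∀ ξ, ‖FT (fun v => ((v ^ 2 * g v : ℝ) : ℂ)) ξ‖ ≤ A * (1 + ξ ^ 2) ^ (-(K : ℝ)) := by
  set a : ℝ := K / (2 * s) with ha
  obtain ⟨N, hN⟩ := exists_nat_ge (K + 2 * a)
  obtain ⟨A, hA0, hA⟩ := hdec N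
  set M := ∫ v, |v| ^ (2 + 2 * s) * g v with hM
  have hM0 : 0 ≤ M := integral_nonneg fun v => mul_nonneg (by positivity) (hnn v)
  refine ⟨4 * A * 3 ^ N / (2 * π) ^ 2 + (2 * π) ^ (2 * s) * M, by positivity, fun ξ => ?_⟩
  have hx1 : 1 ≤ 1 + ξ ^ 2 := by nlinarith [sq_nonneg ξ]
  have hx0 : 0 < 1 + ξ ^ 2 := by positivity
  set h : ℝ := (1 + ξ ^ 2) ^ (-a) with hh
  have ha0 : 0 ≤ a := by positivity
  have hh0 : 0 < h := rpow_pos_of_pos hx0 _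
  have hh1 : h ≤ 1 := rpow_le_one_of_one_le_of_nonpos hx1 (by linarith)
  have hdiff := norm_FT_sq_mul_le hs0.le hs hnn hg hg2 hgp ξ hh0
  set X := (1 + ξ ^ 2) ^ (-(N : ℝ)) with hX
  have hX0 : 0 < X := rpow_pos_of_pos hx0 _
  have hnear : ∀ η, |η - ξ| ≤ 1 → ‖FT (fun v => (g v : ℂ)) η‖ ≤ A * (3 ^ N * X) := fun η hη =>
    (hA η).trans (mul_le_mul_of_nonneg_left (one_add_sq_rpow_neg_le hη N) hA0)
  have n1 := hnear (ξ + h) (by rw [add_sub_cancel_left, abs_of_pos hh0]; exact hh1)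
  have n2 := hnear (ξ - h) (by rw [sub_sub_cancel_left, abs_neg, abs_of_pos hh0]; exact hh1)
  have n3 := hnear ξ (by simp)
  have hXh : X ≤ h ^ 2 * (1 + ξ ^ 2) ^ (-(K : ℝ)) := by
    rw [hX, hh, ← rpow_mul_natCast hx0.le, ← rpow_add hx0]
    refine rpow_le_rpow_of_exponent_le hx1 ?_
    push_cast
    linarith
  have hhs : h ^ (2 * s) = (1 + ξ ^ 2) ^ (-(K : ℝ)) := by
    rw [hh, ← rpow_mul hx0.le, ha]
    congr 1
    field_simp
  set Y := (1 + ξ ^ 2) ^ (-(K : ℝ)) with hY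
  have hpow : (2 * π * h) ^ (2 + 2 * s) = (2 * π * h) ^ 2 * ((2 * π) ^ (2 * s) * Y) := by
    rw [rpow_add (by positivity), mul_rpow (z := 2 * s) (by positivity) hh0.le, hhs]
    norm_cast
  rw [hpow] at hdiff
  have hq : 0 < (2 * π * h) ^ 2 := by positivity
  refine le_of_mul_le_mul_left (hdiff.trans ?_) hq
  have e : (2 * π * h) ^ 2 * ((4 * A * 3 ^ N / (2 * π) ^ 2 + (2 * π) ^ (2 * s) * M) * Y)
      = 4 * (A * (3 ^ N * (h ^ 2 * Y))) + (2 * π * h) ^ 2 * ((2 * π) ^ (2 * s) * Y) * M := by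
    field_simp
  have hfin : A * (3 ^ N * X) ≤ A * (3 ^ N * (h ^ 2 * Y)) := by gcongr
  rw [e]
  linarith

lemma continuous_FT (hg : Integrable g) : Continuous (FT fun v => (g v : ℂ)) := by
  have : (FT fun v => (g v : ℂ)) = fun ξ => ∫ v, fourierExp ξ v * (g v : ℂ) := rfl
  rw [this]
  refine continuous_of_dominated (bound := fun v => ‖g v‖)
    (fun ξ => (integrable_fourierExp_mul hg ξ).aestronglyMeasurable)
    (fun ξ => Filter.Eventually.of_forall fun v => ?_) hg.norm
    (Filter.Eventually.of_forall fun v => ?_)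
  · rw [norm_mul, norm_fourierExp, one_mul, Complex.norm_real]
  · exact (continuous_fourierExp.comp (Continuous.prodMk_left v)).mul continuous_const

/-- A density with rapidly decaying transform and a moment of order `2 + 2s` lies in every
Sobolev space with weight `⟨v⟩²`. -/
theorem integrable_jap_rpow_mul_norm_FT_sq (hs0 : 0 < s) (hs : s ≤ 1) (hnn : ∀ v, 0 ≤ g v)
    (hgj : Integrable fun v => jap v ^ (2 + 2 * s) * g v)
    (hdec : ∀ N : ℕ, ∃ A, 0 ≤ A ∧
      ∀ ξ, ‖FT (fun v => (g v : ℂ)) ξ‖ ≤ A * (1 + ξ ^ 2) ^ (-(N : ℝ))) (k : ℕ) :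
    Integrable fun ξ =>
      jap ξ ^ (2 * (k : ℝ)) * ‖FT (fun v => ((jap v ^ 2 * g v : ℝ) : ℂ)) ξ‖ ^ 2 := by
  have hp0 : 0 ≤ 2 + 2 * s := by linarith
  have hone : ∀ v, 1 ≤ jap v ^ (2 + 2 * s) := fun v => one_le_rpow (one_le_jap v) hp0
  have hg : Integrable g := by
    simpa using integrable_mul_of_abs_le_jap_rpow (C := 1) (φ := fun _ => 1) hgj
      continuous_const fun v => by simpa using hone v
  have hgp : Integrable fun v => |v| ^ (2 + 2 * s) * g v := by
    refine integrable_mul_of_abs_le_jap_rpow (C := 1) hgj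
      (continuous_abs.rpow_const fun v => Or.inr hp0) fun v => ?_
    rw [one_mul, abs_of_nonneg (by positivity)]
    exact rpow_le_rpow (abs_nonneg v) (abs_le_jap v) hp0
  have hjsq : ∀ v, jap v ^ 2 ≤ jap v ^ (2 + 2 * s) := fun v => by
    rw [← rpow_natCast]
    exact rpow_le_rpow_of_exponent_le (one_le_jap v) (by push_cast; linarith)
  have hg2 : Integrable fun v => v ^ 2 * g v := by
    refine integrable_mul_of_abs_le_jap_rpow (C := 1) hgj (continuous_pow 2) fun v => ?_
    rw [one_mul, abs_of_nonneg (by positivity)]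
    refine le_trans ?_ (hjsq v)
    rw [jap_sq]
    linarith
  obtain ⟨A, hA0, hA⟩ := hdec (k + 1)
  obtain ⟨B, hB0, hB⟩ := exists_norm_FT_sq_mul_le hs0 hs hnn hg hg2 hgp hdec (k + 1)
  have hgJ : Integrable fun v => jap v ^ 2 * g v := by
    have e : (fun v => jap v ^ 2 * g v) = fun v => g v + v ^ 2 * g v := by
      ext v; rw [jap_sq]; ring
    rw [e]
    exact hg.add hg2
  have hsum : ∀ ξ, FT (fun v => ((jap v ^ 2 * g v : ℝ) : ℂ)) ξ
      = FT (fun v => (g v : ℂ)) ξ + FT (fun v => ((v ^ 2 * g v : ℝ) : ℂ)) ξ := by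
    intro ξ
    rw [FT_eq, FT_eq, FT_eq, ← MeasureTheory.integral_add (integrable_fourierExp_mul hg ξ)
      (integrable_fourierExp_mul hg2 ξ)]
    refine integral_congr_ae (Filter.Eventually.of_forall fun v => ?_)
    simp only [jap_sq]
    push_cast
    ring
  refine (integrable_inv_one_add_sq.const_mul ((A + B) ^ 2)).mono'
    (((continuous_jap_rpow _).mul ((continuous_FT hgJ).norm.pow 2)).aestronglyMeasurable)
    (Filter.Eventually.of_forall fun ξ => ?_)
  have hx1 : 1 ≤ 1 + ξ ^ 2 := by nlinarith [sq_nonneg ξ]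
  have hx0 : 0 < 1 + ξ ^ 2 := by positivity
  have hn : ‖FT (fun v => ((jap v ^ 2 * g v : ℝ) : ℂ)) ξ‖
      ≤ (A + B) * (1 + ξ ^ 2) ^ (-((k + 1 : ℕ) : ℝ)) := by
    rw [hsum, add_mul]
    exact (norm_add_le _ _).trans (add_le_add (hA ξ) (hB ξ))
  have hj : jap ξ ^ (2 * (k : ℝ)) = (1 + ξ ^ 2) ^ k := by
    rw [rpow_mul (zero_le_one.trans (one_le_jap ξ)), rpow_natCast, rpow_two, jap_sq]
  rw [norm_of_nonneg (by rw [hj]; positivity), hj]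
  calc (1 + ξ ^ 2) ^ k * ‖FT (fun v => ((jap v ^ 2 * g v : ℝ) : ℂ)) ξ‖ ^ 2
      ≤ (1 + ξ ^ 2) ^ k * ((A + B) * (1 + ξ ^ 2) ^ (-((k + 1 : ℕ) : ℝ))) ^ 2 := by gcongr
    _ = (A + B) ^ 2 * ((1 + ξ ^ 2) ^ (k + 2))⁻¹ := by
      rw [rpow_neg hx0.le, rpow_natCast]
      field_simp
      ring
    _ ≤ (A + B) ^ 2 * (1 + ξ ^ 2)⁻¹ := by
      gcongr
      exact le_self_pow₀ hx1 (by omega)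

end SecondDifference

section WeakForm

variable {C₀ s T : ℝ} {f₀ : ℝ → ℝ} {f : ℝ → ℝ → ℝ}

lemma IsWeakKacSolution.integral_mul_eq (h : IsWeakKacSolution C₀ s T f₀ f) {φ : ℝ → ℝ}
    (hφ : ContDiff ℝ 2 φ)
    (hM : ∃ M : ℝ, ∀ v, |φ v| ≤ M ∧ |deriv φ v| ≤ M ∧ |deriv (deriv φ) v| ≤ M)
    {t : ℝ} (ht : t ∈ Set.Icc 0 T) :
    ∫ v, f t v * φ v = (∫ v, f₀ v * φ v) + ∫ τ in (0 : ℝ)..t, ∫ v, ∫ vs,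
      ∫ θ in (-(π / 2))..(π / 2), kacBeta C₀ s θ * f τ vs * f τ v *
        (φ (v * cos θ - vs * sin θ) - φ v) := by
  obtain ⟨M, hM⟩ := hM
  have := h.weak_eq (fun _ => φ) (fun _ _ => 0) (fun _ _ => hasDerivAt_const _ _) (fun _ => hφ)
    ⟨M, fun _ v => ⟨(hM v).1, by simpa using (abs_nonneg _).trans (hM v).1, (hM v).2⟩⟩ t ht
  simp only [mul_zero, MeasureTheory.integral_zero, intervalIntegral.integral_zero,
    zero_add] at this
  linarith

lemma hasDerivAt_cos_mul (a v : ℝ) : HasDerivAt (fun v => cos (a * v)) (-(a * sin (a * v))) v := by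
  simpa [mul_comm] using ((hasDerivAt_id v).const_mul a).cos

lemma hasDerivAt_sin_mul (a v : ℝ) : HasDerivAt (fun v => sin (a * v)) (a * cos (a * v)) v := by
  simpa [mul_comm] using ((hasDerivAt_id v).const_mul a).sin

lemma exists_bound_deriv_cos_mul (a : ℝ) : ∃ M : ℝ, ∀ v, |cos (a * v)| ≤ M ∧
    |deriv (fun v => cos (a * v)) v| ≤ M ∧ |deriv (deriv fun v => cos (a * v)) v| ≤ M := by
  have h1 : deriv (fun v => cos (a * v)) = fun v => -(a * sin (a * v)) :=
    funext fun v => (hasDerivAt_cos_mul a v).deriv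
  have h2 : deriv (fun v => -(a * sin (a * v))) = fun v => -(a * (a * cos (a * v))) :=
    funext fun v => ((hasDerivAt_sin_mul a v).const_mul a).neg.deriv
  refine ⟨1 + |a| + |a| * |a|, fun v => ?_⟩
  rw [h1, h2]
  simp only [abs_neg, abs_mul]
  have hc := abs_cos_le_one (a * v)
  have hs := abs_sin_le_one (a * v)
  have ha := abs_nonneg a
  have e1 := mul_le_mul_of_nonneg_left hs ha
  have e2 := mul_le_mul_of_nonneg_left hc (mul_nonneg ha ha)
  have e3 := mul_nonneg ha ha
  refine ⟨?_, ?_, ?_⟩ <;> linarith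

lemma exists_bound_deriv_sin_mul (a : ℝ) : ∃ M : ℝ, ∀ v, |sin (a * v)| ≤ M ∧
    |deriv (fun v => sin (a * v)) v| ≤ M ∧ |deriv (deriv fun v => sin (a * v)) v| ≤ M := by
  have h1 : deriv (fun v => sin (a * v)) = fun v => a * cos (a * v) :=
    funext fun v => (hasDerivAt_sin_mul a v).deriv
  have h2 : deriv (fun v => a * cos (a * v)) = fun v => a * -(a * sin (a * v)) :=
    funext fun v => ((hasDerivAt_cos_mul a v).const_mul a).deriv
  refine ⟨1 + |a| + |a| * |a|, fun v => ?_⟩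
  rw [h1, h2]
  simp only [abs_neg, abs_mul]
  have hc := abs_cos_le_one (a * v)
  have hs := abs_sin_le_one (a * v)
  have ha := abs_nonneg a
  have e1 := mul_le_mul_of_nonneg_left hc ha
  have e2 := mul_le_mul_of_nonneg_left hs (mul_nonneg ha ha)
  have e3 := mul_nonneg ha ha
  refine ⟨?_, ?_, ?_⟩ <;> linarith

/-- Extension of a solution to nonpositive times by its initial datum. -/
def extendByInitial (f₀ : ℝ → ℝ) (f : ℝ → ℝ → ℝ) (t : ℝ) : ℝ → ℝ := if 0 < t then f t else f₀

lemma extendByInitial_of_pos {t : ℝ} (ht : 0 < t) : extendByInitial f₀ f t = f t := if_pos ht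

lemma extendByInitial_of_nonpos {t : ℝ} (ht : t ≤ 0) : extendByInitial f₀ f t = f₀ :=
  if_neg ht.not_gt

lemma IsWeakKacSolution.FT_re_eq (h : ∀ T, 0 < T → IsWeakKacSolution C₀ s T f₀ f)
    (hC₀ : 0 ≤ C₀) (hs0 : 0 < s) (hs : s < 1 / 2)
    (hnn : ∀ t v, 0 ≤ extendByInitial f₀ f t v)
    (hg : ∀ t, Integrable (extendByInitial f₀ f t))
    (hg1 : ∀ t, Integrable fun v => |v| * extendByInitial f₀ f t v) (ξ t : ℝ) :
    (FT (fun v => (extendByInitial f₀ f t v : ℂ)) ξ).re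
      = (FT (fun v => (extendByInitial f₀ f 0 v : ℂ)) ξ).re + ∫ τ in (0 : ℝ)..max t 0,
        (kacFourier C₀ s (FT fun v => (extendByInitial f₀ f τ v : ℂ)) ξ).re := by
  rcases le_or_gt t 0 with ht | ht
  · simp [max_eq_right ht, extendByInitial_of_nonpos ht, extendByInitial_of_nonpos le_rfl]
  rw [max_eq_left ht.le, FT_re (hg t), FT_re (hg 0), extendByInitial_of_pos ht,
    extendByInitial_of_nonpos le_rfl, (h t ht).integral_mul_eq (by fun_prop)
    (exists_bound_deriv_cos_mul (2 * π * ξ)) ⟨ht.le, le_rfl⟩]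
  congr 1
  refine integral_congr_ae (Filter.Eventually.of_forall fun τ hτ => ?_)
  rw [Set.uIoc_of_le ht.le] at hτ
  rw [← collision_cos hC₀ hs0 hs (hnn τ) (hg τ) (hg1 τ) ξ, extendByInitial_of_pos hτ.1]

lemma IsWeakKacSolution.FT_im_eq (h : ∀ T, 0 < T → IsWeakKacSolution C₀ s T f₀ f)
    (hC₀ : 0 ≤ C₀) (hs0 : 0 < s) (hs : s < 1 / 2)
    (hnn : ∀ t v, 0 ≤ extendByInitial f₀ f t v)
    (hg : ∀ t, Integrable (extendByInitial f₀ f t))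
    (hg1 : ∀ t, Integrable fun v => |v| * extendByInitial f₀ f t v) (ξ t : ℝ) :
    (FT (fun v => (extendByInitial f₀ f t v : ℂ)) ξ).im
      = (FT (fun v => (extendByInitial f₀ f 0 v : ℂ)) ξ).im + ∫ τ in (0 : ℝ)..max t 0,
        (kacFourier C₀ s (FT fun v => (extendByInitial f₀ f τ v : ℂ)) ξ).im := by
  rcases le_or_gt t 0 with ht | ht
  · simp [max_eq_right ht, extendByInitial_of_nonpos ht, extendByInitial_of_nonpos le_rfl]
  rw [max_eq_left ht.le, FT_im (hg t), FT_im (hg 0), extendByInitial_of_pos ht,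
    extendByInitial_of_nonpos le_rfl, (h t ht).integral_mul_eq (by fun_prop)
    (exists_bound_deriv_sin_mul (2 * π * ξ)) ⟨ht.le, le_rfl⟩, neg_add,
    ← intervalIntegral.integral_neg]
  congr 1
  refine integral_congr_ae (Filter.Eventually.of_forall fun τ hτ => ?_)
  rw [Set.uIoc_of_le ht.le] at hτ
  rw [← neg_eq_iff_eq_neg.2 (collision_sin hC₀ hs0 hs (hnn τ) (hg τ) (hg1 τ) ξ),
    extendByInitial_of_pos hτ.1]

end WeakForm

/-- `H^{+∞}` regularizing effect for the non-cutoff homogeneous Kac equation: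
if `0 < s < 1/2`, `f₀ ∈ L¹_{2+2s} ∩ L log L` is nonnegative, not identically
zero, and `f ∈ L∞((0,∞); L¹_{2+2s} ∩ L log L)` is a nonnegative weak solution,
then `⟨v⟩² f(t,·) ∈ H^k(ℝ)` for every `t > 0` and `k ∈ ℕ`, i.e.
`f(t,·) ∈ H^{+∞}₂(ℝ)`. -/
theorem kac_Hinfty_regularizing_effect
    (C₀ s : ℝ) (hC₀ : 0 < C₀) (hs0 : 0 < s) (hs : s < 1 / 2)
    (f₀ : ℝ → ℝ) (f : ℝ → ℝ → ℝ)
    (hf₀nn : ∀ v, 0 ≤ f₀ v) (hf₀ne : 0 < ∫ v : ℝ, f₀ v)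
    (hf₀L1 : Integrable fun v : ℝ => jap v ^ (2 + 2 * s) * f₀ v)
    (hf₀LL : Integrable fun v : ℝ => f₀ v * Real.log (1 + f₀ v))
    (hfLinf : ∃ Cb : ℝ, ∀ t : ℝ, 0 < t →
        (Integrable fun v : ℝ => jap v ^ (2 + 2 * s) * f t v) ∧
        (Integrable fun v : ℝ => f t v * Real.log (1 + f t v)) ∧
        (∫ v : ℝ, jap v ^ (2 + 2 * s) * f t v) ≤ Cb ∧
        (∫ v : ℝ, f t v * Real.log (1 + f t v)) ≤ Cb)
    (hweak : ∀ T : ℝ, 0 < T → IsWeakKacSolution C₀ s T f₀ f) :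
    ∀ t : ℝ, 0 < t → ∀ k : ℕ,
      Integrable fun ξ : ℝ =>
        jap ξ ^ (2 * (k : ℝ)) * ‖FT (fun v => ((jap v ^ 2 * f t v : ℝ) : ℂ)) ξ‖ ^ 2 := by
  obtain ⟨Cb, hCb⟩ := hfLinf
  have hp1 : 1 ≤ 2 + 2 * s := by linarith
  have hone : ∀ v, 1 ≤ jap v ^ (2 + 2 * s) := fun v =>
    one_le_rpow (one_le_jap v) (zero_le_one.trans hp1)
  have habs : ∀ v, |v| ≤ jap v ^ (2 + 2 * s) := fun v =>
    (abs_le_jap v).trans (self_le_rpow_of_one_le (one_le_jap v) hp1)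
  set g := extendByInitial f₀ f with hgdef
  have hgpos : ∀ {t}, 0 < t → g t = f t := extendByInitial_of_pos
  have hgnonpos : ∀ {t}, t ≤ 0 → g t = f₀ := extendByInitial_of_nonpos
  have hnn : ∀ t v, 0 ≤ g t v := by
    intro t v
    rcases le_or_gt t 0 with ht | ht
    · rw [hgnonpos ht]; exact hf₀nn v
    · rw [hgpos ht]; exact (hweak t ht).nonneg t ⟨ht.le, le_rfl⟩ v
  have hmass : ∀ t, ∫ v, g t v = ∫ v, f₀ v := by
    intro t
    rcases le_or_gt t 0 with ht | ht
    · rw [hgnonpos ht]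
    · rw [hgpos ht]; exact (hweak t ht).mass t ⟨ht.le, le_rfl⟩
  have hgj : ∀ t, Integrable fun v => jap v ^ (2 + 2 * s) * g t v := by
    intro t
    rcases le_or_gt t 0 with ht | ht
    · rw [hgnonpos ht]; exact hf₀L1
    · rw [hgpos ht]; exact (hCb t ht).1
  obtain ⟨B, hB⟩ : ∃ B, ∀ t, ∫ v, jap v ^ (2 + 2 * s) * g t v ≤ B := by
    refine ⟨max (∫ v, jap v ^ (2 + 2 * s) * f₀ v) Cb, fun t => ?_⟩
    rcases le_or_gt t 0 with ht | ht
    · rw [hgnonpos ht]; exact le_max_left _ _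
    · rw [hgpos ht]; exact (hCb t ht).2.2.1.trans (le_max_right _ _)
  have hg : ∀ t, Integrable (g t) := fun t => by
    simpa using integrable_mul_of_abs_le_jap_rpow (C := 1) (φ := fun _ => 1) (hgj t)
      continuous_const fun v => by simpa using hone v
  have hg1 : ∀ t, Integrable fun v => |v| * g t v := fun t =>
    integrable_mul_of_abs_le_jap_rpow (C := 1) (hgj t) continuous_abs
      fun v => by simpa using habs v
  have hB1 : ∀ t, ∫ v, |v| * g t v ≤ B := fun t =>
    (integral_mono (hg1 t) (hgj t) fun v =>
      mul_le_mul_of_nonneg_right (habs v) (hnn t v)).trans (hB t)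
  set F : ℝ → ℝ → ℂ := fun t => FT fun v => (g t v : ℂ) with hF
  have hm : ∀ t ξ, ‖F t ξ‖ ≤ ∫ v, f₀ v := fun t ξ => (norm_FT_le (hnn t) ξ).trans_eq (hmass t)
  have hL : ∀ t ξ η, ‖F t ξ - F t η‖ ≤ 2 * π * B * |ξ - η| := fun t ξ η =>
    (norm_FT_sub_le (hnn t) (hg t) (hg1 t) ξ η).trans
      (mul_le_mul_of_nonneg_right
        (mul_le_mul_of_nonneg_left (hB1 t) (by positivity)) (abs_nonneg _))
  have h0 : ∀ t, F t 0 = ((∫ v, f₀ v : ℝ) : ℂ) := fun t => by rw [← hmass t]; exact FT_zero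
  have hlt : ∀ t η, η ≠ 0 → ‖F t η‖ < ∫ v, f₀ v := fun t η hη => by
    rw [← hmass t]
    exact norm_FT_lt (hnn t) (hg t) (by rwa [hmass t]) hη
  obtain ⟨hc, hd⟩ := continuous_and_hasDerivAt_of_weak hC₀.le hs0 hs hm hL
    (IsWeakKacSolution.FT_re_eq hweak hC₀.le hs0 hs hnn hg hg1)
    (IsWeakKacSolution.FT_im_eq hweak hC₀.le hs0 hs hnn hg hg1)
  intro t ht k
  rw [← hgpos ht]
  exact integrable_jap_rpow_mul_norm_FT_sq hs0 (by linarith) (hnn t) (hgj t)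
    (exists_norm_le_rpow_of_bobylev hC₀ hs0 hs hf₀ne hm hL h0 hlt hc hd ht) k
end
end

section
/- Let k ≥ 0 and let h ∈ L¹_k(ℝ³) be nonnegative, radially symmetric (h(Av) = h(v) for a.e. v ∈ ℝ³ and every rotation A ∈ SO(3)), and uniformly integrable (for every ε > 0 there exists δ > 0 such that ∫_B h < ε for every measurable B ⊂ ℝ³ of Lebesgue measure at most δ). Then the marginal f(u) := ∫_{ℝ²} h(v₁, v₂, u) dv₁ dv₂ is a nonnegative even function belonging to L¹_k(ℝ), and f is uniformly integrable on ℝ: for every ε > 0 there exists δ₀ > 0 such that ∫_A f < ε for every measurable A ⊂ ℝ of Lebesgue measure at most δ₀. -/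
open MeasureTheory Real

noncomputable section

/-- Japanese bracket on `ℝ³`. -/
def jap3 (v : EuclideanSpace ℝ (Fin 3)) : ℝ := Real.sqrt (1 + ‖v‖ ^ 2)

/-- The point `(v₁, v₂, u) ∈ ℝ³`. -/
def pt3 (v₁ v₂ u : ℝ) : EuclideanSpace ℝ (Fin 3) :=
  (WithLp.equiv 2 (Fin 3 → ℝ)).symm ![v₁, v₂, u]

theorem measurePreserving_pt3 :
    MeasurePreserving (fun z : ℝ × ℝ × ℝ => pt3 z.2.1 z.2.2 z.1) := by
  have h1 : MeasurePreserving (Prod.map id (MeasurableEquiv.finTwoArrow (α := ℝ)).symm)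
      (volume : Measure (ℝ × ℝ × ℝ)) (volume : Measure (ℝ × (Fin 2 → ℝ))) :=
    (MeasurePreserving.id volume).prod ((volume_preserving_finTwoArrow ℝ).symm _)
  have h2 := (volume_preserving_piFinSuccAbove (fun _ : Fin 3 => ℝ) 2).symm
  have h3 := (PiLp.volume_preserving_toLp (Fin 3)).comp (h2.comp h1)
  have heq : (fun z : ℝ × ℝ × ℝ => pt3 z.2.1 z.2.2 z.1) = WithLp.toLp 2 ∘
      (MeasurableEquiv.piFinSuccAbove (fun _ : Fin 3 => ℝ) 2).symm ∘
        Prod.map id (MeasurableEquiv.finTwoArrow (α := ℝ)).symm := by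
    ext z i
    fin_cases i <;> rfl
  exact heq ▸ h3

/-- The rotation by `π` about the second coordinate axis. -/
def halfTurn : EuclideanSpace ℝ (Fin 3) ≃ₗᵢ[ℝ] EuclideanSpace ℝ (Fin 3) :=
  LinearIsometryEquiv.piLpCongrRight 2
    ![LinearIsometryEquiv.neg ℝ, LinearIsometryEquiv.refl ℝ ℝ, LinearIsometryEquiv.neg ℝ]

theorem halfTurn_pt3 (a b c : ℝ) : halfTurn (pt3 a b c) = pt3 (-a) b (-c) := by
  ext i
  fin_cases i <;> simp [halfTurn, pt3]

theorem det_halfTurn :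
    LinearMap.det (halfTurn.toLinearEquiv :
      EuclideanSpace ℝ (Fin 3) →ₗ[ℝ] EuclideanSpace ℝ (Fin 3)) = 1 := by
  rw [← LinearMap.det_toMatrix (EuclideanSpace.basisFun (Fin 3) ℝ).toBasis]
  rw [show LinearMap.toMatrix (EuclideanSpace.basisFun (Fin 3) ℝ).toBasis
      (EuclideanSpace.basisFun (Fin 3) ℝ).toBasis (halfTurn.toLinearEquiv :
        EuclideanSpace ℝ (Fin 3) →ₗ[ℝ] EuclideanSpace ℝ (Fin 3)) =
      Matrix.diagonal ![-1, 1, -1] by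
    ext i j
    fin_cases i <;> fin_cases j <;> simp [LinearMap.toMatrix_apply, halfTurn]]
  simp [Matrix.det_diagonal, Fin.prod_univ_three]

theorem measurable_jap : Measurable jap := by
  unfold jap
  fun_prop

theorem measurable_jap3 : Measurable jap3 := by
  unfold jap3
  fun_prop

theorem one_le_jap3 (v : EuclideanSpace ℝ (Fin 3)) : 1 ≤ jap3 v :=
  Real.one_le_sqrt.2 (by nlinarith [sq_nonneg ‖v‖])

theorem jap_le_jap3_pt3 (a b u : ℝ) : jap u ≤ jap3 (pt3 a b u) := by
  refine Real.sqrt_le_sqrt ?_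
  rw [EuclideanSpace.real_norm_sq_eq, Fin.sum_univ_three]
  simp only [pt3, WithLp.equiv_symm_apply, Matrix.cons_val]
  nlinarith [sq_nonneg a, sq_nonneg b]

theorem MeasureTheory.Integrable.exists_setIntegral_lt {α : Type*} [MeasurableSpace α] {μ : Measure α}
    {f : α → ℝ} (hf : Integrable f μ) {ε : ℝ} (hε : 0 < ε) :
    ∃ δ : ℝ, 0 < δ ∧ ∀ s : Set α, μ s ≤ ENNReal.ofReal δ → ∫ x in s, f x ∂μ < ε := by
  obtain ⟨δ, hδ, hs⟩ := exists_pos_setLIntegral_lt_of_measure_lt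
    (f := fun x => ‖f x‖ₑ) hf.2.ne (ε := ENNReal.ofReal ε) (by simpa using hε)
  obtain ⟨δ', hδ', hlt⟩ := ENNReal.lt_iff_exists_nnreal_btwn.1 hδ
  refine ⟨δ', by exact_mod_cast hδ', fun s hμs => ?_⟩
  have hlt' := hs s (lt_of_le_of_lt (by simpa using hμs) hlt)
  have key := (enorm_integral_le_lintegral_enorm (μ := μ.restrict s) f).trans_lt hlt'
  rw [← ofReal_norm, ENNReal.ofReal_lt_ofReal_iff hε] at key
  exact (le_abs_self _).trans_lt key

/-- The marginal `f(u) = ∫_{ℝ²} h(v₁,v₂,u) dv₁ dv₂` of a nonnegative, radially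
symmetric, uniformly integrable `h ∈ L¹_k(ℝ³)` is a nonnegative even function
in `L¹_k(ℝ)` which is uniformly integrable on `ℝ`. -/
theorem marginal_of_radial (k : ℝ) (hk : 0 ≤ k) (h : EuclideanSpace ℝ (Fin 3) → ℝ)
    (hnn : ∀ v, 0 ≤ h v)
    (hL1k : Integrable fun v : EuclideanSpace ℝ (Fin 3) => jap3 v ^ k * h v)
    (hrad : ∀ A : EuclideanSpace ℝ (Fin 3) ≃ₗᵢ[ℝ] EuclideanSpace ℝ (Fin 3),
      LinearMap.det (A.toLinearEquiv : EuclideanSpace ℝ (Fin 3) →ₗ[ℝ] EuclideanSpace ℝ (Fin 3))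
          = 1 →
      ∀ᵐ v : EuclideanSpace ℝ (Fin 3), h (A v) = h v)
    (hui : ∀ ε : ℝ, 0 < ε → ∃ δ : ℝ, 0 < δ ∧
      ∀ B : Set (EuclideanSpace ℝ (Fin 3)), MeasurableSet B →
        volume B ≤ ENNReal.ofReal δ → (∫ v in B, h v) < ε) :
    (∀ u : ℝ, 0 ≤ ∫ p : ℝ × ℝ, h (pt3 p.1 p.2 u)) ∧
    (∀ᵐ u : ℝ, (∫ p : ℝ × ℝ, h (pt3 p.1 p.2 (-u))) = ∫ p : ℝ × ℝ, h (pt3 p.1 p.2 u)) ∧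
    (Integrable fun u : ℝ => jap u ^ k * ∫ p : ℝ × ℝ, h (pt3 p.1 p.2 u)) ∧
    (∀ ε : ℝ, 0 < ε → ∃ δ₀ : ℝ, 0 < δ₀ ∧
      ∀ A : Set ℝ, MeasurableSet A → volume A ≤ ENNReal.ofReal δ₀ →
        (∫ u in A, ∫ p : ℝ × ℝ, h (pt3 p.1 p.2 u)) < ε) := by
  have hmeas : AEStronglyMeasurable h volume := by
    have hm : AEStronglyMeasurable (fun v => (jap3 v ^ k)⁻¹ * (jap3 v ^ k * h v)) volume :=
      (measurable_jap3.pow_const k).inv.aestronglyMeasurable.mul hL1k.1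
    refine hm.congr (.of_forall fun v => ?_)
    have : jap3 v ^ k ≠ 0 := (rpow_pos_of_pos (one_pos.trans_le (one_le_jap3 v)) k).ne'
    simp [inv_mul_cancel_left₀ this]
  have hprod := measurePreserving_pt3.integrable_comp_of_integrable hL1k
  have hmeas' := hmeas.comp_measurePreserving measurePreserving_pt3
  have hweight : Integrable fun u : ℝ => jap u ^ k * ∫ p : ℝ × ℝ, h (pt3 p.1 p.2 u) := by
    have hdom : Integrable (fun z : ℝ × ℝ × ℝ => jap z.1 ^ k * h (pt3 z.2.1 z.2.2 z.1))
        ((volume : Measure ℝ).prod volume) := by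
      refine hprod.mono
        (((measurable_jap.comp measurable_fst).pow_const k).aestronglyMeasurable.mul hmeas')
        (.of_forall fun z => ?_)
      have h0 : 0 ≤ jap z.1 := Real.sqrt_nonneg _
      have hle := jap_le_jap3_pt3 z.2.1 z.2.2 z.1
      simp only [Function.comp_apply, norm_mul]
      gcongr
      rw [Real.norm_of_nonneg (rpow_nonneg h0 k),
        Real.norm_of_nonneg (rpow_nonneg (h0.trans hle) k)]
      exact rpow_le_rpow h0 hle hk
    simpa only [integral_const_mul] using hdom.integral_prod_left
  have hint : Integrable fun u : ℝ => ∫ p : ℝ × ℝ, h (pt3 p.1 p.2 u) := by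
    have hdom : Integrable (fun z : ℝ × ℝ × ℝ => h (pt3 z.2.1 z.2.2 z.1))
        ((volume : Measure ℝ).prod volume) := by
      refine hprod.mono hmeas' (.of_forall fun z => ?_)
      simp only [Function.comp_apply, norm_mul]
      refine le_mul_of_one_le_left (norm_nonneg _) ?_
      exact (one_le_rpow (one_le_jap3 _) hk).trans (le_abs_self _)
    exact hdom.integral_prod_left
  refine ⟨fun u => integral_nonneg fun p => hnn _, ?_, hweight, fun ε hε => ?_⟩
  · have hae := measurePreserving_pt3.quasiMeasurePreserving.ae (hrad halfTurn det_halfTurn)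
    simp only [halfTurn_pt3] at hae
    filter_upwards [Measure.ae_ae_of_ae_prod hae] with u hu
    have hneg : MeasurePreserving
        (Prod.map (MeasurableEquiv.neg ℝ) (MeasurableEquiv.refl ℝ))
        (volume : Measure (ℝ × ℝ)) (volume : Measure (ℝ × ℝ)) :=
      (Measure.measurePreserving_neg (volume : Measure ℝ)).prod (MeasurePreserving.id volume)
    rw [← hneg.integral_comp
      ((MeasurableEquiv.neg ℝ).prodCongr (MeasurableEquiv.refl ℝ)).measurableEmbedding]
    exact integral_congr_ae hu
  · obtain ⟨δ, hδ, hlt⟩ := hint.exists_setIntegral_lt hε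
    exact ⟨δ, hδ, fun A _ hA => hlt A hA⟩
end
end
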